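/- arXiv:1908.04096 — 7 statements merged into one kernel-verified Lean document; each statement's English description precedes it below -/
import Mathlib

section
/- Let D = (D₁, v₁, u₁) ▽ (D₂, v₂, u₂) be the directed Hajós join of two disjoint non-empty digraphs D₁ and D₂. Then χ⃗(D) ≥ min{χ⃗(D₁), χ⃗(D₂)}. -/
/-- A finite digraph on the vertex type `ℕ`: a finite vertex set together with a
finite set of arcs (ordered pairs of vertices), loopless, without parallel arcs
(but opposite arcs between two vertices are allowed). -/
structure Digr where
  verts : Finset ℕ
  arcs : Finset (ℕ × ℕ)
  arcs_sub : ∀ a ∈ arcs, a.1 ∈ verts ∧ a.2 ∈ verts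
  no_loops : ∀ a ∈ arcs, a.1 ≠ a.2

namespace Digr

/-- `D'` is a subdigraph of `D`. -/
def Sub (D' D : Digr) : Prop := D'.verts ⊆ D.verts ∧ D'.arcs ⊆ D.arcs

/-- An acyclic coloring of `D` with `n` colors: no directed cycle is monochromatic.
A monochromatic directed cycle through `v` is exactly a nontrivial closed walk from `v`
to `v` along arcs whose endpoints always get equal colors. -/
def GoodColoring (D : Digr) (n : ℕ) (φ : ℕ → Fin n) : Prop :=
  ∀ v, ¬ Relation.TransGen (fun x y => (x, y) ∈ D.arcs ∧ φ x = φ y) v v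

/-- `D` admits an acyclic coloring with `n` colors. -/
def Colorable (D : Digr) (n : ℕ) : Prop := ∃ φ : ℕ → Fin n, D.GoodColoring n φ

/-- The dichromatic number of `D`. -/
noncomputable def dichrom (D : Digr) : ℕ := sInf {n | D.Colorable n}

/-- `D` is `k`-critical: its dichromatic number is `k` and every proper subdigraph
has smaller dichromatic number. -/
def Critical (k : ℕ) (D : Digr) : Prop :=
  D.dichrom = k ∧ ∀ D' : Digr, D'.Sub D → D' ≠ D → D'.dichrom < k

/-- Deletion of a vertex. -/
def delete (D : Digr) (v : ℕ) : Digr where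
  verts := D.verts.erase v
  arcs := D.arcs.filter (fun a => a.1 ≠ v ∧ a.2 ≠ v)
  arcs_sub := by
    intro a ha
    rw [Finset.mem_filter] at ha
    obtain ⟨ha, h1, h2⟩ := ha
    have h := D.arcs_sub a ha
    exact ⟨Finset.mem_erase.mpr ⟨h1, h.1⟩, Finset.mem_erase.mpr ⟨h2, h.2⟩⟩
  no_loops := fun a ha => D.no_loops a (Finset.mem_filter.mp ha).1

/-- The subdigraph of `D` induced by a set `S` of vertices. -/
def induce (D : Digr) (S : Finset ℕ) : Digr where
  verts := D.verts ∩ S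
  arcs := D.arcs.filter (fun a => a.1 ∈ S ∧ a.2 ∈ S)
  arcs_sub := by
    intro a ha
    rw [Finset.mem_filter] at ha
    obtain ⟨ha, h1, h2⟩ := ha
    have h := D.arcs_sub a ha
    exact ⟨Finset.mem_inter.mpr ⟨h.1, h1⟩, Finset.mem_inter.mpr ⟨h.2, h2⟩⟩
  no_loops := fun a ha => D.no_loops a (Finset.mem_filter.mp ha).1

/-- Out-neighborhood of `v` in `D`. -/
def outNbrs (D : Digr) (v : ℕ) : Finset ℕ := D.verts.filter (fun y => (v, y) ∈ D.arcs)

/-- In-neighborhood of `v` in `D`. -/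
def inNbrs (D : Digr) (v : ℕ) : Finset ℕ := D.verts.filter (fun x => (x, v) ∈ D.arcs)

/-- Out-degree. -/
def outDeg (D : Digr) (v : ℕ) : ℕ := (D.outNbrs v).card

/-- In-degree. -/
def inDeg (D : Digr) (v : ℕ) : ℕ := (D.inNbrs v).card

/-- `D` is (weakly) connected, i.e. its underlying graph is connected. -/
def Conn (D : Digr) : Prop :=
  ∀ x ∈ D.verts, ∀ y ∈ D.verts,
    Relation.ReflTransGen (fun a b => (a, b) ∈ D.arcs ∨ (b, a) ∈ D.arcs) x y

/-- `D` is strongly connected. -/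
def StronglyConn (D : Digr) : Prop :=
  ∀ x ∈ D.verts, ∀ y ∈ D.verts,
    Relation.ReflTransGen (fun a b => (a, b) ∈ D.arcs) x y

/-- `H` has no separating vertex. -/
def NoSepVertex (H : Digr) : Prop := ∀ v ∈ H.verts, (H.delete v).Conn

/-- `B` is a block of `D`: a maximal connected subdigraph of `D` without a
separating vertex. -/
def IsBlock (B D : Digr) : Prop :=
  B.Sub D ∧ B.Conn ∧ B.NoSepVertex ∧
    ∀ B' : Digr, B'.Sub D → B'.Conn → B'.NoSepVertex → B.Sub B' → B' = B

/-- `B` is a directed cycle (of length ≥ 2). -/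
def IsDirCycle (B : Digr) : Prop :=
  ∃ (n : ℕ) (f : ℕ → ℕ), 2 ≤ n ∧ Set.InjOn f ↑(Finset.range n) ∧
    B.verts = (Finset.range n).image f ∧
    B.arcs = (Finset.range n).image (fun i => (f i, f ((i + 1) % n)))

/-- `B` is a bidirected cycle of length `n`. -/
def IsBidirCycle (B : Digr) (n : ℕ) : Prop :=
  ∃ f : ℕ → ℕ, Set.InjOn f ↑(Finset.range n) ∧
    B.verts = (Finset.range n).image f ∧
    B.arcs = (Finset.range n).image (fun i => (f i, f ((i + 1) % n))) ∪
      (Finset.range n).image (fun i => (f ((i + 1) % n), f i))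

/-- `B` is a bidirected complete graph: every ordered pair of distinct vertices is an arc. -/
def IsBidirComplete (B : Digr) : Prop :=
  B.arcs = (B.verts ×ˢ B.verts).filter (fun a => a.1 ≠ a.2)

/-- `D` contains a bidirected complete graph on `k` vertices as a subdigraph. -/
def ContainsK (k : ℕ) (D : Digr) : Prop :=
  ∃ S : Finset ℕ, S ⊆ D.verts ∧ S.card = k ∧
    ∀ x ∈ S, ∀ y ∈ S, x ≠ y → (x, y) ∈ D.arcs

/-- `D` is the Dirac join of the disjoint digraphs `D1` and `D2`: their union
together with all arcs in both directions between them. -/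
def IsDiracJoin (D D1 D2 : Digr) : Prop :=
  Disjoint D1.verts D2.verts ∧
  D.verts = D1.verts ∪ D2.verts ∧
  D.arcs = D1.arcs ∪ D2.arcs ∪ D1.verts ×ˢ D2.verts ∪ D2.verts ×ˢ D1.verts

/-- `D` is the directed Hajós join `(D1, v1, u1) ▽ (D2, v2, u2)` of the disjoint
digraphs `D1` and `D2`: delete the arcs `u1v1` and `v2u2`, identify `v1` and `v2`
(the merged vertex is represented by `v1`), and add the arc `u1u2`. -/
def IsHajosJoin (D D1 D2 : Digr) (u1 v1 v2 u2 : ℕ) : Prop :=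
  Disjoint D1.verts D2.verts ∧
  (u1, v1) ∈ D1.arcs ∧ (v2, u2) ∈ D2.arcs ∧
  D.verts = D1.verts ∪ D2.verts.erase v2 ∧
  D.arcs = D1.arcs.erase (u1, v1) ∪
      (D2.arcs.erase (v2, u2)).image
        (Prod.map (fun x => if x = v2 then v1 else x) (fun x => if x = v2 then v1 else x)) ∪
      {(u1, u2)}

/-- `D` is the bidirected Hajós join `(D1, v1, u1) ▽̄ (D2, v2, u2)` of the disjoint
digraphs `D1` and `D2`: delete both arcs of the digon between `u1` and `v1` and both
arcs of the digon between `u2` and `v2`, identify `v1` and `v2` (the merged vertex is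
represented by `v1`), and add both arcs `u1u2` and `u2u1`. -/
def IsBidirHajosJoin (D D1 D2 : Digr) (u1 v1 v2 u2 : ℕ) : Prop :=
  Disjoint D1.verts D2.verts ∧
  (u1, v1) ∈ D1.arcs ∧ (v1, u1) ∈ D1.arcs ∧
  (u2, v2) ∈ D2.arcs ∧ (v2, u2) ∈ D2.arcs ∧
  D.verts = D1.verts ∪ D2.verts.erase v2 ∧
  D.arcs = ((D1.arcs.erase (u1, v1)).erase (v1, u1)) ∪
      (((D2.arcs.erase (v2, u2)).erase (u2, v2)).image
        (Prod.map (fun x => if x = v2 then v1 else x) (fun x => if x = v2 then v1 else x))) ∪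
      {(u1, u2), (u2, u1)}

/-- `D'` is obtained from `D` by identifying the non-empty independent set `I`
with the (new) vertex `v`. -/
def IsIdent (D' D : Digr) (I : Finset ℕ) (v : ℕ) : Prop :=
  I.Nonempty ∧ I ⊆ D.verts ∧
  (∀ x ∈ I, ∀ y ∈ I, (x, y) ∉ D.arcs) ∧
  (v ∈ I ∨ v ∉ D.verts) ∧
  D'.verts = (D.verts \ I) ∪ {v} ∧
  D'.arcs = D.arcs.filter (fun a => a.1 ∉ I ∧ a.2 ∉ I) ∪
      (D.arcs.filter (fun a => a.1 ∈ I ∧ a.2 ∉ I)).image (fun a => (v, a.2)) ∪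
      (D.arcs.filter (fun a => a.1 ∉ I ∧ a.2 ∈ I)).image (fun a => (a.1, v))

/-- Isomorphism of digraphs. -/
def Iso (D D' : Digr) : Prop :=
  ∃ f : ℕ → ℕ, Set.BijOn f ↑D.verts ↑D'.verts ∧
    ∀ x ∈ D.verts, ∀ y ∈ D.verts, ((x, y) ∈ D.arcs ↔ (f x, f y) ∈ D'.arcs)

/-- The Hajós-`k`-constructible digraphs: the smallest family of digraphs (closed
under isomorphism) containing the bidirected complete graph on `k` vertices and
closed under directed Hajós joins and identification of independent sets. -/
inductive HajosConstr (k : ℕ) : Digr → Prop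
  | base (D : Digr) : D.verts.card = k → D.IsBidirComplete → HajosConstr k D
  | join (D D1 D2 : Digr) (u1 v1 v2 u2 : ℕ) :
      HajosConstr k D1 → HajosConstr k D2 →
      IsHajosJoin D D1 D2 u1 v1 v2 u2 → HajosConstr k D
  | ident (D' D : Digr) (I : Finset ℕ) (v : ℕ) :
      HajosConstr k D → IsIdent D' D I v → HajosConstr k D'
  | iso (D D' : Digr) : HajosConstr k D → Iso D D' → HajosConstr k D'

/-- `D` is a directed Ore join of the disjoint digraphs `D1` and `D2`: a directed
Hajós join followed by identifying each `w` in a set `A1 ⊆ V(D1 - v1)` with `ι w`,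
where `ι` is a bijection from `A1` onto a subset of `V(D2 - v2)` with `ι u1 ≠ u2`. -/
def IsOreJoin (D D1 D2 : Digr) (u1 v1 v2 u2 : ℕ) : Prop :=
  ∃ (H : Digr) (A1 : Finset ℕ) (ι : ℕ → ℕ),
    IsHajosJoin H D1 D2 u1 v1 v2 u2 ∧
    A1 ⊆ D1.verts.erase v1 ∧
    A1.image ι ⊆ D2.verts.erase v2 ∧
    Set.InjOn ι ↑A1 ∧
    (u1 ∈ A1 → ι u1 ≠ u2) ∧
    D.verts = H.verts.image (fun x => if x ∈ A1 then ι x else x) ∧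
    D.arcs = H.arcs.image
      (Prod.map (fun x => if x ∈ A1 then ι x else x) (fun x => if x ∈ A1 then ι x else x))

/-- `D` is a bidirected Ore join of the disjoint digraphs `D1` and `D2`: a bidirected
Hajós join followed by the same kind of identification as in the directed Ore join. -/
def IsBidirOreJoin (D D1 D2 : Digr) (u1 v1 v2 u2 : ℕ) : Prop :=
  ∃ (H : Digr) (A1 : Finset ℕ) (ι : ℕ → ℕ),
    IsBidirHajosJoin H D1 D2 u1 v1 v2 u2 ∧
    A1 ⊆ D1.verts.erase v1 ∧
    A1.image ι ⊆ D2.verts.erase v2 ∧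
    Set.InjOn ι ↑A1 ∧
    (u1 ∈ A1 → ι u1 ≠ u2) ∧
    D.verts = H.verts.image (fun x => if x ∈ A1 then ι x else x) ∧
    D.arcs = H.arcs.image
      (Prod.map (fun x => if x ∈ A1 then ι x else x) (fun x => if x ∈ A1 then ι x else x))

/-- The Ore-`k`-constructible digraphs: the smallest family of digraphs (closed under
isomorphism) containing the bidirected complete graph on `k` vertices and closed
under directed and bidirected Ore joins. -/
inductive OreConstr (k : ℕ) : Digr → Prop
  | base (D : Digr) : D.verts.card = k → D.IsBidirComplete → OreConstr k D
  | dirJoin (D D1 D2 : Digr) (u1 v1 v2 u2 : ℕ) :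
      OreConstr k D1 → OreConstr k D2 →
      IsOreJoin D D1 D2 u1 v1 v2 u2 → OreConstr k D
  | bidirJoin (D D1 D2 : Digr) (u1 v1 v2 u2 : ℕ) :
      OreConstr k D1 → OreConstr k D2 →
      IsBidirOreJoin D D1 D2 u1 v1 v2 u2 → OreConstr k D
  | iso (D D' : Digr) : OreConstr k D → Iso D D' → OreConstr k D'

/-- The set of low vertices of `D` (for the parameter `k`): the vertices with
out-degree and in-degree both equal to `k - 1`. -/
def lowVerts (D : Digr) (k : ℕ) : Finset ℕ :=
  D.verts.filter (fun v => D.outDeg v = k - 1 ∧ D.inDeg v = k - 1)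

end Digr

/-- A closed walk either avoids the pair `(a, b)` or can be cut at it. -/
theorem transGen_cut {R R' : ℕ → ℕ → Prop} {a b : ℕ}
    (hR : ∀ x y, R x y → (x = a ∧ y = b) ∨ R' x y) {x y : ℕ} (h : Relation.TransGen R x y) :
    Relation.TransGen R' x y ∨
      (R a b ∧ Relation.ReflTransGen R' x a ∧ Relation.ReflTransGen R' b y) := by
  induction h with
  | single h =>
    rcases hR _ _ h with ⟨rfl, rfl⟩ | h'
    · exact Or.inr ⟨h, .refl, .refl⟩
    · exact Or.inl (.single h')
  | tail _ h ih =>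
    rcases hR _ _ h with ⟨rfl, rfl⟩ | h'
    · rcases ih with ih | ih
      · exact Or.inr ⟨h, ih.to_reflTransGen, .refl⟩
      · exact Or.inr ⟨h, ih.2.1, .refl⟩
    · rcases ih with ih | ih
      · exact Or.inl (ih.tail h')
      · exact Or.inr ⟨ih.1, ih.2.1, ih.2.2.tail h'⟩

theorem Digr.exists_colorable (D : Digr) : ∃ n, D.Colorable n := by
  refine ⟨D.verts.sup id + 1, fun x => ⟨min x (D.verts.sup id), by omega⟩, ?_⟩
  have key : ∀ x y, ¬ ((x, y) ∈ D.arcs ∧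
      (⟨min x (D.verts.sup id), by omega⟩ : Fin (D.verts.sup id + 1)) =
        ⟨min y (D.verts.sup id), by omega⟩) := by
    rintro x y ⟨h, e⟩
    have hs := D.arcs_sub _ h
    have hn := D.no_loops _ h
    have hx : x ≤ D.verts.sup id := Finset.le_sup (f := id) hs.1
    have hy : y ≤ D.verts.sup id := Finset.le_sup (f := id) hs.2
    have e' := congrArg Fin.val e
    simp only at e' hn
    omega
  intro v hv
  cases hv with
  | single h => exact key _ _ h
  | tail _ h => exact key _ _ h

open Digr in
/-- If `D = (D1, v1, u1) ▽ (D2, v2, u2)` is the directed Hajós join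
of the disjoint non-empty digraphs `D1` and `D2`, then
`χ⃗(D) ≥ min (χ⃗(D1)) (χ⃗(D2))`. -/
theorem hajos_join_dichromatic_ge (D D1 D2 : Digr) (u1 v1 v2 u2 : ℕ)
    (h1 : D1.verts.Nonempty) (h2 : D2.verts.Nonempty)
    (hD : IsHajosJoin D D1 D2 u1 v1 v2 u2) :
    min D1.dichrom D2.dichrom ≤ D.dichrom := by
  have hc : D.Colorable D.dichrom := Nat.sInf_mem (s := {n | D.Colorable n}) D.exists_colorable
  obtain ⟨φ, hφ⟩ := hc
  obtain ⟨-, ha1, ha2, -, hA⟩ := hD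
  by_contra! hlt
  rw [lt_min_iff] at hlt
  have n1 : ¬ D1.Colorable D.dichrom := fun h => (Nat.sInf_le h).not_gt hlt.1
  have n2 : ¬ D2.Colorable D.dichrom := fun h => (Nat.sInf_le h).not_gt hlt.2
  set f : ℕ → ℕ := fun x => if x = v2 then v1 else x with hf
  have g1 : ¬ D1.GoodColoring _ φ := fun h => n1 ⟨_, h⟩
  have g2 : ¬ D2.GoodColoring _ (fun x => φ (f x)) := fun h => n2 ⟨_, h⟩
  unfold GoodColoring at g1 g2
  push Not at g1 g2
  obtain ⟨w1, c1⟩ := g1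
  obtain ⟨w2, c2⟩ := g2
  have hu2 : u2 ≠ v2 := fun h => D2.no_loops _ ha2 h.symm
  have fu : f u2 = u2 := by simp [hf, hu2]
  have fv : f v2 = v1 := by simp [hf]
  have k1 := transGen_cut (a := u1) (b := v1)
    (R' := fun x y => (x, y) ∈ D.arcs ∧ φ x = φ y) (by
      rintro x y ⟨h, e⟩
      by_cases hxy : x = u1 ∧ y = v1
      · exact Or.inl hxy
      · refine Or.inr ⟨?_, e⟩
        rw [hA]
        refine Finset.mem_union_left _ (Finset.mem_union_left _ (Finset.mem_erase.2 ⟨?_, h⟩))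
        simpa using hxy) c1
  have k2 := transGen_cut (a := v2) (b := u2)
    (R' := fun x y => (f x, f y) ∈ D.arcs ∧ φ (f x) = φ (f y)) (by
      rintro x y ⟨h, e⟩
      by_cases hxy : x = v2 ∧ y = u2
      · exact Or.inl hxy
      · refine Or.inr ⟨?_, e⟩
        rw [hA]
        refine Finset.mem_union_left _ (Finset.mem_union_right _
          (Finset.mem_image.2 ⟨(x, y), Finset.mem_erase.2 ⟨?_, h⟩, rfl⟩))
        simpa using hxy) c2
  rcases k1 with k1 | ⟨⟨-, e1⟩, p1, q1⟩
  · exact hφ _ k1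
  rcases k2 with k2 | ⟨⟨-, e2⟩, p2, q2⟩
  · exact hφ _ (Relation.TransGen.lift f (fun _ _ h => h) _ _ k2)
  have r2 := Relation.ReflTransGen.lift (p := fun x y => (x, y) ∈ D.arcs ∧ φ x = φ y) f
    (fun _ _ h => h) _ _ (q2.trans p2)
  simp only [Function.onFun, fu, fv] at r2 e2
  have ha : (u1, u2) ∈ D.arcs := by
    rw [hA]
    exact Finset.mem_union_right _ (Finset.mem_singleton_self _)
  exact hφ v1 ((Relation.TransGen.tail' (q1.trans p1) ⟨ha, e1.trans e2⟩).trans_left r2)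
end

section
/- Let D = (D₁, v₁, u₁) ▽ (D₂, v₂, u₂) be the directed Hajós join of two disjoint non-empty digraphs D₁ and D₂. If χ⃗(D₁) = χ⃗(D₂) = k and k ≥ 3, then χ⃗(D) = k. -/
/-- A closed walk either avoids the arc `u w` or yields a path from `w` to `u` avoiding it. -/
theorem hj_split {R : ℕ → ℕ → Prop} (u w : ℕ) {a b : ℕ} (h : Relation.TransGen R a b) :
    Relation.TransGen (fun x y => R x y ∧ (x, y) ≠ (u, w)) a b ∨
    (R u w ∧ Relation.ReflTransGen (fun x y => R x y ∧ (x, y) ≠ (u, w)) a u ∧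
      Relation.ReflTransGen (fun x y => R x y ∧ (x, y) ≠ (u, w)) w b) := by
  induction h with
  | single h =>
    rename_i b
    by_cases e : (a, b) = (u, w)
    · obtain ⟨rfl, rfl⟩ := Prod.mk.inj e
      exact Or.inr ⟨h, .refl, .refl⟩
    · exact Or.inl (.single ⟨h, e⟩)
  | @tail b c _ h ih =>
    by_cases e : (b, c) = (u, w)
    · obtain ⟨rfl, rfl⟩ := Prod.mk.inj e
      rcases ih with ih | ih
      · exact Or.inr ⟨h, ih.to_reflTransGen, .refl⟩
      · exact Or.inr ⟨h, ih.2.1, .refl⟩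
    · rcases ih with ih | ih
      · exact Or.inl (ih.tail ⟨h, e⟩)
      · exact Or.inr ⟨ih.1, ih.2.1, ih.2.2.tail ⟨h, e⟩⟩

theorem hj_split_closed {R : ℕ → ℕ → Prop} (u w : ℕ) {a : ℕ} (h : Relation.TransGen R a a) :
    Relation.TransGen (fun x y => R x y ∧ (x, y) ≠ (u, w)) a a ∨
    (R u w ∧ Relation.ReflTransGen (fun x y => R x y ∧ (x, y) ≠ (u, w)) w u) := by
  rcases hj_split u w h with h | h
  · exact Or.inl h
  · exact Or.inr ⟨h.1, h.2.2.trans h.2.1⟩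

/-- A good coloring has a rank function increasing along monochromatic arcs. -/
theorem hj_rank (D : Digr) (n : ℕ) (φ : ℕ → Fin n) (h : D.GoodColoring n φ) :
    ∃ f : ℕ → ℤ, ∀ x y, (x, y) ∈ D.arcs → φ x = φ y → f x < f y := by
  classical
  refine ⟨fun x => ((D.verts.filter (fun z =>
    Relation.TransGen (fun x y => (x, y) ∈ D.arcs ∧ φ x = φ y) z x)).card : ℤ), ?_⟩
  intro x y hxy hc
  have : (D.verts.filter (fun z =>
    Relation.TransGen (fun x y => (x, y) ∈ D.arcs ∧ φ x = φ y) z x)).card <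
    (D.verts.filter (fun z =>
    Relation.TransGen (fun x y => (x, y) ∈ D.arcs ∧ φ x = φ y) z y)).card := by
    apply Finset.card_lt_card
    rw [Finset.ssubset_iff_of_subset]
    · refine ⟨x, ?_, ?_⟩
      · exact Finset.mem_filter.2 ⟨(D.arcs_sub _ hxy).1, .single ⟨hxy, hc⟩⟩
      · intro hx
        exact h x (Finset.mem_filter.1 hx).2
    · intro z hz
      rw [Finset.mem_filter] at hz ⊢
      exact ⟨hz.1, hz.2.tail ⟨hxy, hc⟩⟩
  exact Int.ofNat_lt.2 this

theorem hj_good_of_rank (D : Digr) (n : ℕ) (φ : ℕ → Fin n) (f : ℕ → ℤ)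
    (h : ∀ x y, (x, y) ∈ D.arcs → φ x = φ y → f x < f y) : D.GoodColoring n φ := by
  intro v hv
  have key : ∀ a b, Relation.TransGen (fun x y => (x, y) ∈ D.arcs ∧ φ x = φ y) a b →
      f a < f b := by
    intro a b hab
    induction hab with
    | single hmm => exact h _ _ hmm.1 hmm.2
    | tail _ hmm ih => exact ih.trans (h _ _ hmm.1 hmm.2)
  exact lt_irrefl _ (key v v hv)

theorem hj_lift {R S : ℕ → ℕ → Prop} (f : ℕ → ℕ) (m : ∀ x y, R x y → S (f x) (f y)) {a b : ℕ}
    (h : Relation.TransGen R a b) : Relation.TransGen S (f a) (f b) := by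
  induction h with
  | single h => exact .single (m _ _ h)
  | tail _ h ih => exact ih.tail (m _ _ h)

theorem hj_rlift {R S : ℕ → ℕ → Prop} (f : ℕ → ℕ) (m : ∀ x y, R x y → S (f x) (f y)) {a b : ℕ}
    (h : Relation.ReflTransGen R a b) : Relation.ReflTransGen S (f a) (f b) := by
  induction h with
  | refl => exact .refl
  | tail _ h ih => exact ih.tail (m _ _ h)

theorem hj_lower (D D1 D2 : Digr) (u1 v1 v2 u2 n : ℕ)
    (hD : Digr.IsHajosJoin D D1 D2 u1 v1 v2 u2) (hc : D.Colorable n) :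
    D1.Colorable n ∨ D2.Colorable n := by
  obtain ⟨hdis, ha1, ha2, -, harcs⟩ := hD
  obtain ⟨φ, hφ⟩ := hc
  by_contra hno
  push Not at hno
  obtain ⟨hn1, hn2⟩ := hno
  have hne2 : u2 ≠ v2 := fun e => D2.no_loops _ ha2 e.symm
  have b1 : ¬ D1.GoodColoring n φ := fun h => hn1 ⟨φ, h⟩
  have b2 : ¬ D2.GoodColoring n (fun x => φ (if x = v2 then v1 else x)) := fun h => hn2 ⟨_, h⟩
  unfold Digr.GoodColoring at b1 b2
  push Not at b1 b2
  obtain ⟨a, hra⟩ := b1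
  obtain ⟨b, hrb⟩ := b2
  have m1 : ∀ x y, (((x, y) ∈ D1.arcs ∧ φ x = φ y) ∧ (x, y) ≠ (u1, v1)) →
      ((x, y) ∈ D.arcs ∧ φ x = φ y) := by
    rintro x y ⟨⟨h, hmm⟩, hnn⟩
    refine ⟨?_, hmm⟩
    rw [harcs]
    simp only [Finset.mem_union, Finset.mem_erase]
    exact Or.inl (Or.inl ⟨hnn, h⟩)
  have m2 : ∀ x y, (((x, y) ∈ D2.arcs ∧ φ (if x = v2 then v1 else x) =
        φ (if y = v2 then v1 else y)) ∧ (x, y) ≠ (v2, u2)) →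
      (((if x = v2 then v1 else x), (if y = v2 then v1 else y)) ∈ D.arcs ∧
        φ (if x = v2 then v1 else x) = φ (if y = v2 then v1 else y)) := by
    rintro x y ⟨⟨h, hmm⟩, hnn⟩
    refine ⟨?_, hmm⟩
    rw [harcs]
    refine Finset.mem_union_left _ (Finset.mem_union_right _ ?_)
    exact Finset.mem_image.2 ⟨(x, y), Finset.mem_erase.2 ⟨hnn, h⟩, rfl⟩
  rcases hj_split_closed u1 v1 hra with h | ⟨⟨-, hc1⟩, p1⟩
  · exact hφ a (hj_lift (S := fun x y => (x, y) ∈ D.arcs ∧ φ x = φ y) id m1 h)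
  rcases hj_split_closed v2 u2 hrb with h | ⟨⟨-, hc2⟩, p2⟩
  · exact hφ _ (hj_lift (S := fun x y => (x, y) ∈ D.arcs ∧ φ x = φ y) (fun x => if x = v2 then v1 else x) m2 h)
  have q1 := hj_rlift (S := fun x y => (x, y) ∈ D.arcs ∧ φ x = φ y) id m1 p1
  have q2 := hj_rlift (S := fun x y => (x, y) ∈ D.arcs ∧ φ x = φ y) (fun x => if x = v2 then v1 else x) m2 p2
  simp only [id, if_neg hne2, if_true] at q1 q2 hc2
  have e : (u1, u2) ∈ D.arcs ∧ φ u1 = φ u2 := by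
    refine ⟨?_, hc1.trans hc2⟩
    rw [harcs]
    simp
  exact hφ v1 ((Relation.TransGen.tail' q1 e).trans_left q2)

theorem hj_upper (D D1 D2 : Digr) (u1 v1 v2 u2 n : ℕ)
    (hD : Digr.IsHajosJoin D D1 D2 u1 v1 v2 u2)
    (hc1 : D1.Colorable n) (hc2 : D2.Colorable n) : D.Colorable n := by
  obtain ⟨hdis, ha1, ha2, -, harcs⟩ := hD
  obtain ⟨φ1, hφ1⟩ := hc1
  obtain ⟨φ2, hφ2⟩ := hc2
  obtain ⟨f1, hf1⟩ := hj_rank D1 n φ1 hφ1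
  obtain ⟨f2, hf2⟩ := hj_rank D2 n φ2 hφ2
  have hne2 : u2 ≠ v2 := fun e => D2.no_loops _ ha2 e.symm
  have hin1 : ∀ x ∈ D1.verts, x ∉ D2.verts := fun x hx hxx =>
    Finset.disjoint_left.1 hdis hx hxx
  have hv1 := (D1.arcs_sub _ ha1).2
  have hu1 := (D1.arcs_sub _ ha1).1
  have hu2 := (D2.arcs_sub _ ha2).2
  simp only at hv1 hu1 hu2
  let π := Equiv.swap (φ2 v2) (φ1 v1)
  have hπ : π (φ2 v2) = φ1 v1 := Equiv.swap_apply_left _ _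
  let M : ℤ := f1 u1 - f1 v1 - (f2 u2 - f2 v2) + 1
  let φ : ℕ → Fin n := fun x => if x ∈ D2.verts then π (φ2 x) else φ1 x
  let g : ℕ → ℤ := fun x => f2 x - f2 v2 + if φ2 x = φ2 v2 then 0 else M
  let f : ℕ → ℤ := fun x => if x ∈ D2.verts then g x else f1 x - f1 v1
  have φD1 : ∀ x ∈ D1.verts, φ x = φ1 x := fun x hx => if_neg (hin1 x hx)
  have fD1 : ∀ x ∈ D1.verts, f x = f1 x - f1 v1 := fun x hx => if_neg (hin1 x hx)
  have φD2 : ∀ x ∈ D2.verts, φ (if x = v2 then v1 else x) = π (φ2 x) := by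
    intro x hx
    split_ifs with h
    · rw [φD1 _ hv1, h, hπ]
    · exact if_pos hx
  have fD2 : ∀ x ∈ D2.verts, f (if x = v2 then v1 else x) = g x := by
    intro x hx
    split_ifs with h
    · rw [fD1 _ hv1, h]
      simp [g]
    · exact if_pos hx
  refine ⟨φ, hj_good_of_rank D n φ f ?_⟩
  intro x y hxy hcol
  rw [harcs] at hxy
  simp only [Finset.mem_union, Finset.mem_singleton] at hxy
  rcases hxy with (h | h) | h
  · have h := Finset.mem_of_mem_erase h
    have hs := D1.arcs_sub _ h
    simp only at hs
    rw [φD1 _ hs.1, φD1 _ hs.2] at hcol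
    rw [fD1 _ hs.1, fD1 _ hs.2]
    have := hf1 _ _ h hcol
    linarith
  · obtain ⟨⟨a, b⟩, hab, e⟩ := Finset.mem_image.1 h
    have hab := Finset.mem_of_mem_erase hab
    have hs := D2.arcs_sub _ hab
    simp only at hs
    obtain ⟨rfl, rfl⟩ := Prod.mk.inj e
    simp only [φD2 _ hs.1, φD2 _ hs.2, fD2 _ hs.1, fD2 _ hs.2] at hcol ⊢
    have hcol := π.injective hcol
    have := hf2 _ _ hab hcol
    simp only [g, hcol]
    linarith
  · obtain ⟨rfl, rfl⟩ := Prod.mk.inj h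
    have e1 := φD2 _ hu2
    have e2 := fD2 _ hu2
    rw [if_neg hne2] at e1 e2
    rw [φD1 _ hu1, e1] at hcol
    rw [fD1 _ hu1, e2]
    simp only [g]
    split_ifs with h
    · have l2 := hf2 _ _ ha2 h.symm
      rw [h, hπ] at hcol
      have l1 := hf1 _ _ ha1 hcol
      linarith
    · simp only [M]
      linarith

theorem hj_colorable (D : Digr) (k : ℕ) (hk : 3 ≤ k) (h : D.dichrom = k) : D.Colorable k := by
  have hne : {n | D.Colorable n}.Nonempty := by
    by_contra he
    rw [Set.not_nonempty_iff_eq_empty] at he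
    rw [Digr.dichrom, he, Nat.sInf_empty] at h
    omega
  have := Nat.sInf_mem hne
  rw [← h]
  exact this

open Digr in
/-- If `D = (D1, v1, u1) ▽ (D2, v2, u2)` is the directed Hajós join of
the disjoint non-empty digraphs `D1` and `D2`, `χ⃗(D1) = χ⃗(D2) = k` and `k ≥ 3`,
then `χ⃗(D) = k`. -/
theorem hajos_join_dichromatic_eq (D D1 D2 : Digr) (u1 v1 v2 u2 : ℕ) (k : ℕ)
    (h1 : D1.verts.Nonempty) (h2 : D2.verts.Nonempty)
    (hD : IsHajosJoin D D1 D2 u1 v1 v2 u2)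
    (hk : 3 ≤ k) (hd1 : D1.dichrom = k) (hd2 : D2.dichrom = k) :
    D.dichrom = k := by
  have hc := hj_upper D D1 D2 u1 v1 v2 u2 k hD (hj_colorable D1 k hk hd1) (hj_colorable D2 k hk hd2)
  apply le_antisymm
  · exact Nat.sInf_le hc
  · have hm : D.Colorable D.dichrom := Nat.sInf_mem (s := {n | D.Colorable n}) ⟨k, hc⟩
    rcases hj_lower D D1 D2 u1 v1 v2 u2 _ hD hm with h | h
    · calc k = D1.dichrom := hd1.symm
        _ ≤ _ := Nat.sInf_le h
    · calc k = D2.dichrom := hd2.symm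
        _ ≤ _ := Nat.sInf_le h
end

section
/- Let D = (D₁, v₁, u₁) ▽ (D₂, v₂, u₂) be the directed Hajós join of two disjoint non-empty digraphs D₁ and D₂, and let k ≥ 3. If both D₁ and D₂ are k-critical, then D is k-critical. -/
namespace Digr

theorem tlift {r s : ℕ → ℕ → Prop} (f : ℕ → ℕ) (h : ∀ x y, r x y → s (f x) (f y)) {x y : ℕ}
    (hxy : Relation.TransGen r x y) : Relation.TransGen s (f x) (f y) := by
  induction hxy with
  | single h' => exact .single (h _ _ h')
  | tail _ h' ih => exact ih.tail (h _ _ h')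

theorem rlift {r s : ℕ → ℕ → Prop} (f : ℕ → ℕ) (h : ∀ x y, r x y → s (f x) (f y)) {x y : ℕ}
    (hxy : Relation.ReflTransGen r x y) : Relation.ReflTransGen s (f x) (f y) := by
  induction hxy with
  | refl => exact .refl
  | tail _ h' ih => exact ih.tail (h _ _ h')

theorem tmono {r s : ℕ → ℕ → Prop} (h : ∀ x y, r x y → s x y) {x y : ℕ}
    (hxy : Relation.TransGen r x y) : Relation.TransGen s x y := tlift id h hxy

theorem rmono {r s : ℕ → ℕ → Prop} (h : ∀ x y, r x y → s x y) {x y : ℕ}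
    (hxy : Relation.ReflTransGen r x y) : Relation.ReflTransGen s x y := rlift id h hxy

/-- Monochromatic arcs. -/
def Mono (A : Finset (ℕ × ℕ)) {n : ℕ} (φ : ℕ → Fin n) (x y : ℕ) : Prop :=
  (x, y) ∈ A ∧ φ x = φ y

/-- Acyclicity of a coloring with respect to an arc set. -/
def Acyc (A : Finset (ℕ × ℕ)) {n : ℕ} (φ : ℕ → Fin n) : Prop :=
  ∀ v, ¬ Relation.TransGen (Mono A φ) v v

theorem Acyc.mono {A B : Finset (ℕ × ℕ)} {n : ℕ} {φ : ℕ → Fin n} (h : Acyc A φ)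
    (hBA : B ⊆ A) : Acyc B φ := fun v hv =>
  h v (tmono (fun _ _ hxy => ⟨hBA hxy.1, hxy.2⟩) hv)

theorem Acyc.comp {A : Finset (ℕ × ℕ)} {n m : ℕ} {φ : ℕ → Fin n} (h : Acyc A φ)
    (f : Fin n → Fin m) (hf : Function.Injective f) : Acyc A (fun x => f (φ x)) := fun v hv =>
  h v (tmono (fun _ _ hxy => ⟨hxy.1, hf hxy.2⟩) hv)

theorem Colorable.mono {D : Digr} {n m : ℕ} (h : D.Colorable n) (hnm : n ≤ m) :
    D.Colorable m := by
  obtain ⟨φ, hφ⟩ := h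
  exact ⟨fun x => Fin.castLE hnm (φ x), Acyc.comp hφ _ (Fin.castLE_injective hnm)⟩

theorem exists_colorable_s4 (D : Digr) : ∃ n, D.Colorable n := by
  refine ⟨D.verts.sup id + 1, fun x => Fin.ofNat _ x, ?_⟩
  have key : ∀ x y, ¬ Mono D.arcs (fun x => Fin.ofNat (D.verts.sup id + 1) x) x y := by
    rintro x y ⟨hxy, hc⟩
    have hs := D.arcs_sub _ hxy
    have hx : x ≤ D.verts.sup id := Finset.le_sup (f := id) hs.1
    have hy : y ≤ D.verts.sup id := Finset.le_sup (f := id) hs.2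
    have h := congrArg Fin.val hc
    simp only [Fin.val_ofNat] at h
    rw [Nat.mod_eq_of_lt (by omega), Nat.mod_eq_of_lt (by omega)] at h
    exact D.no_loops _ hxy h
  intro v hv
  obtain ⟨w, hw, -⟩ := Relation.TransGen.head'_iff.mp hv
  exact key _ _ hw

theorem dichrom_le_iff (D : Digr) (m : ℕ) : D.dichrom ≤ m ↔ D.Colorable m := by
  constructor
  · intro h
    exact Colorable.mono (Nat.sInf_mem (s := {n | D.Colorable n}) D.exists_colorable_s4) h
  · intro h
    exact Nat.sInf_le h

/-- Deletion of an arc. -/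
def delArc (D : Digr) (a : ℕ × ℕ) : Digr where
  verts := D.verts
  arcs := D.arcs.erase a
  arcs_sub := fun b hb => D.arcs_sub b (Finset.mem_of_mem_erase hb)
  no_loops := fun b hb => D.no_loops b (Finset.mem_of_mem_erase hb)

theorem colorable_succ (D : Digr) (a : ℕ × ℕ) (m : ℕ) (h : (D.delArc a).Colorable m) :
    D.Colorable (m + 1) := by
  obtain ⟨φ, hφ⟩ := h
  refine ⟨fun x => if x = a.1 then Fin.last m else (φ x).castSucc, fun v hv => ?_⟩
  refine hφ v (tmono ?_ hv)
  rintro x y ⟨hxy, hc⟩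
  have hl := D.no_loops _ hxy
  simp only at hl hc
  have h1 : ∀ z, (φ z).castSucc ≠ Fin.last m := fun z => (Fin.castSucc_lt_last _).ne
  by_cases hx : x = a.1
  · rw [if_pos hx] at hc
    by_cases hy : y = a.1
    · exact absurd (hx.trans hy.symm) hl
    · rw [if_neg hy] at hc
      exact absurd hc.symm (h1 y)
  · rw [if_neg hx] at hc
    by_cases hy : y = a.1
    · rw [if_pos hy] at hc
      exact absurd hc (h1 x)
    · rw [if_neg hy] at hc
      refine ⟨Finset.mem_erase.mpr ⟨?_, hxy⟩, Fin.castSucc_injective _ hc⟩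
      rintro rfl
      exact hx rfl

theorem through_arc {r r' : ℕ → ℕ → Prop} {a b : ℕ}
    (hr : ∀ x y, r x y → r' x y ∨ (x = a ∧ y = b)) {x y : ℕ} (h : Relation.TransGen r x y) :
    Relation.TransGen r' x y ∨ (Relation.ReflTransGen r' x a ∧ Relation.ReflTransGen r' b y) := by
  induction h with
  | single h =>
    rcases hr _ _ h with h | ⟨rfl, rfl⟩
    · exact Or.inl (.single h)
    · exact Or.inr ⟨.refl, .refl⟩
  | tail _ h ih =>
    rcases hr _ _ h with h | ⟨rfl, rfl⟩
    · rcases ih with ih | ⟨i1, i2⟩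
      · exact Or.inl (ih.tail h)
      · exact Or.inr ⟨i1, i2.tail h⟩
    · rcases ih with ih | ⟨i1, i2⟩
      · exact Or.inr ⟨ih.to_reflTransGen, .refl⟩
      · exact Or.inr ⟨i1, .refl⟩

theorem path_of_not_colorable {D : Digr} {m : ℕ} (hD : ¬ D.Colorable m) {a b : ℕ}
    {φ : ℕ → Fin m} (hφ : Acyc (D.arcs.erase (a, b)) φ) :
    Relation.ReflTransGen (Mono (D.arcs.erase (a, b)) φ) b a := by
  by_contra hcon
  refine hD ⟨φ, fun v hv => ?_⟩
  have := through_arc (r' := Mono (D.arcs.erase (a, b)) φ) (a := a) (b := b) (by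
    rintro x y ⟨hxy, hc⟩
    by_cases h : x = a ∧ y = b
    · exact Or.inr h
    · refine Or.inl ⟨Finset.mem_erase.mpr ⟨?_, hxy⟩, hc⟩
      intro he
      exact h ⟨congrArg Prod.fst he, congrArg Prod.snd he⟩) hv
  rcases this with h | ⟨h1, h2⟩
  · exact hφ v h
  · exact hcon (h2.trans h1)

theorem color_eq_of_path {A : Finset (ℕ × ℕ)} {m : ℕ} {φ : ℕ → Fin m} {x y : ℕ}
    (h : Relation.ReflTransGen (Mono A φ) x y) : φ x = φ y := by
  induction h with
  | refl => rfl
  | tail _ h ih => exact ih.trans h.2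

theorem acyc_retract {r r1 r2 : ℕ → ℕ → Prop} (ρ τ : ℕ → ℕ)
    (hr : ∀ x y, r x y → r1 (ρ x) (ρ y) ∨ (r2 (τ x) (τ y) ∧ ρ x = ρ y))
    (h1 : ∀ v, ¬ Relation.TransGen r1 v v) (h2 : ∀ v, ¬ Relation.TransGen r2 v v) :
    ∀ v, ¬ Relation.TransGen r v v := by
  have key : ∀ x y, Relation.TransGen r x y →
      Relation.TransGen r1 (ρ x) (ρ y) ∨ (Relation.TransGen r2 (τ x) (τ y) ∧ ρ x = ρ y) := by
    intro x y h
    induction h with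
    | single h =>
      rcases hr _ _ h with h | ⟨h, he⟩
      · exact Or.inl (.single h)
      · exact Or.inr ⟨.single h, he⟩
    | tail _ h ih =>
      rcases hr _ _ h with h | ⟨h, he⟩
      · rcases ih with ih | ⟨_, i2⟩
        · exact Or.inl (ih.tail h)
        · rw [← i2] at h
          exact Or.inl (.single h)
      · rcases ih with ih | ⟨i1, i2⟩
        · rw [he] at ih
          exact Or.inl ih
        · exact Or.inr ⟨i1.tail h, i2.trans he⟩
  intro v hv
  rcases key v v hv with h | ⟨h, -⟩
  · exact h1 _ h
  · exact h2 _ h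

theorem glue1 {V1 V2 : Finset ℕ} (hdis : Disjoint V1 V2) {u1 v1 v2 u2 : ℕ}
    (hu1 : u1 ∈ V1) (hv1 : v1 ∈ V1) (hu2 : u2 ∈ V2)
    {A1 A2 B : Finset (ℕ × ℕ)} (hA1 : ∀ a ∈ A1, a.1 ∈ V1 ∧ a.2 ∈ V1)
    (hA2 : ∀ a ∈ A2, a.1 ∈ V2 ∧ a.2 ∈ V2) {m : ℕ} {φ1 φ2 : ℕ → Fin m}
    (h1 : Acyc A1 φ1) (h2 : Acyc A2 φ2) (hv : φ1 v1 = φ2 v2)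
    (hB : ∀ x y, (x, y) ∈ B → (x, y) ∈ A1 ∨
      (∃ x' y', (x', y') ∈ A2 ∧ (if x' = v2 then v1 else x') = x ∧
        (if y' = v2 then v1 else y') = y) ∨
      (x = u1 ∧ y = u2 ∧ (u1, v1) ∈ A1 ∧ φ2 u2 = φ2 v2)) :
    Acyc B (fun x => if x ∈ V1 then φ1 x else φ2 x) := by
  have hd : ∀ x, x ∈ V2 → x ∉ V1 := fun x h2 h1 => Finset.disjoint_left.mp hdis h1 h2
  refine acyc_retract (r1 := Mono A1 φ1) (r2 := Mono A2 φ2)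
    (fun x => if x ∈ V1 then x else v1) (fun x => if x = v1 then v2 else x) ?_ h1 h2
  rintro x y ⟨hxy, hc⟩
  simp only at hc ⊢
  rcases hB x y hxy with h | ⟨x', y', h, rfl, rfl⟩ | ⟨rfl, rfl, h, he⟩
  · left
    have hs := hA1 _ h
    simp only at hs
    rw [if_pos hs.1, if_pos hs.2] at hc ⊢
    exact ⟨h, hc⟩
  · right
    have hs := hA2 _ h
    simp only at hs
    have hτ : ∀ z, z ∈ V2 → (if (if z = v2 then v1 else z) = v1 then v2 else
        (if z = v2 then v1 else z)) = z := by
      intro z hz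
      have := hd z hz
      grind
    have hφ : ∀ z, z ∈ V2 → (if (if z = v2 then v1 else z) ∈ V1 then
        φ1 (if z = v2 then v1 else z) else φ2 (if z = v2 then v1 else z)) = φ2 z := by
      intro z hz
      have := hd z hz
      by_cases hz2 : z = v2
      · simp [hz2, hv1, hv]
      · simp [hz2, this]
    have hρ : ∀ z, z ∈ V2 → (if (if z = v2 then v1 else z) ∈ V1 then
        (if z = v2 then v1 else z) else v1) = v1 := by
      intro z hz
      have := hd z hz
      grind
    rw [hφ _ hs.1, hφ _ hs.2] at hc
    rw [hτ _ hs.1, hτ _ hs.2, hρ _ hs.1, hρ _ hs.2]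
    exact ⟨⟨h, hc⟩, rfl⟩
  · left
    rw [if_pos hu1, if_neg (hd _ hu2)] at hc ⊢
    exact ⟨h, by rw [hc, he, hv]⟩

theorem glue2 {V1 V2 : Finset ℕ} (hdis : Disjoint V1 V2) {u1 v1 v2 u2 : ℕ}
    (hu1 : u1 ∈ V1) (hv1 : v1 ∈ V1) (hu2 : u2 ∈ V2)
    {A1 A2 B : Finset (ℕ × ℕ)} (hA1 : ∀ a ∈ A1, a.1 ∈ V1 ∧ a.2 ∈ V1)
    (hA2 : ∀ a ∈ A2, a.1 ∈ V2 ∧ a.2 ∈ V2) {m : ℕ} {φ1 φ2 : ℕ → Fin m}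
    (h1 : Acyc A1 φ1) (h2 : Acyc A2 φ2) (hv : φ1 v1 = φ2 v2)
    (hB : ∀ x y, (x, y) ∈ B → (x, y) ∈ A1 ∨
      (∃ x' y', (x', y') ∈ A2 ∧ (if x' = v2 then v1 else x') = x ∧
        (if y' = v2 then v1 else y') = y) ∨
      (x = u1 ∧ y = u2 ∧ (v2, u2) ∈ A2 ∧ φ1 u1 = φ1 v1)) :
    Acyc B (fun x => if x ∈ V1 then φ1 x else φ2 x) := by
  have hd : ∀ x, x ∈ V2 → x ∉ V1 := fun x h2 h1 => Finset.disjoint_left.mp hdis h1 h2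
  refine acyc_retract (r1 := Mono A2 φ2) (r2 := Mono A1 φ1)
    (fun x => if x ∈ V1 then v2 else x) id ?_ h2 h1
  rintro x y ⟨hxy, hc⟩
  simp only [id] at hc ⊢
  rcases hB x y hxy with h | ⟨x', y', h, rfl, rfl⟩ | ⟨rfl, rfl, h, he⟩
  · right
    have hs := hA1 _ h
    simp only at hs
    rw [if_pos hs.1, if_pos hs.2] at hc ⊢
    exact ⟨⟨h, hc⟩, rfl⟩
  · left
    have hs := hA2 _ h
    simp only at hs
    have hφ : ∀ z, z ∈ V2 → (if (if z = v2 then v1 else z) ∈ V1 then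
        φ1 (if z = v2 then v1 else z) else φ2 (if z = v2 then v1 else z)) = φ2 z := by
      intro z hz
      have := hd z hz
      by_cases hz2 : z = v2
      · simp [hz2, hv1, hv]
      · simp [hz2, this]
    have hρ : ∀ z, z ∈ V2 → (if (if z = v2 then v1 else z) ∈ V1 then
        v2 else (if z = v2 then v1 else z)) = z := by
      intro z hz
      have := hd z hz
      by_cases hz2 : z = v2
      · simp [hz2, hv1]
      · simp [hz2, this]
    rw [hφ _ hs.1, hφ _ hs.2] at hc
    rw [hρ _ hs.1, hρ _ hs.2]
    exact ⟨h, hc⟩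
  · left
    rw [if_pos hu1, if_neg (hd _ hu2)] at hc ⊢
    exact ⟨h, by rw [← hc, he, hv]⟩

theorem Critical.not_colorable {D : Digr} {m : ℕ} (h : D.Critical (m + 1)) :
    ¬ D.Colorable m := by
  rw [← dichrom_le_iff, h.1]
  omega

theorem Critical.acyc_erase {D : Digr} {m : ℕ} (h : D.Critical (m + 1)) {a : ℕ × ℕ}
    (ha : a ∈ D.arcs) : ∃ φ : ℕ → Fin m, Acyc (D.arcs.erase a) φ := by
  have h1 := h.2 (D.delArc a) ⟨Finset.Subset.refl _, Finset.erase_subset _ _⟩ (by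
    intro he
    have : a ∈ (D.delArc a).arcs := by rw [he]; exact ha
    exact Finset.notMem_erase _ _ this)
  exact (dichrom_le_iff (D.delArc a) m).mp (by omega)

theorem Critical.exists_arc {D : Digr} {m : ℕ} (h : D.Critical (m + 1)) {w : ℕ}
    (hw : w ∈ D.verts) : ∃ a ∈ D.arcs, a.1 = w ∨ a.2 = w := by
  by_contra hcon
  push Not at hcon
  have h1 := h.2 (D.delete w) ⟨Finset.erase_subset _ _, Finset.filter_subset _ _⟩ (by
    intro he
    have : w ∈ (D.delete w).verts := by rw [he]; exact hw
    exact Finset.notMem_erase _ _ this)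
  obtain ⟨φ, hφ⟩ := (dichrom_le_iff _ m).mp (show (D.delete w).dichrom ≤ m by omega)
  refine h.not_colorable ⟨φ, Acyc.mono hφ ?_⟩
  intro a ha
  exact Finset.mem_filter.mpr ⟨ha, hcon a ha⟩

theorem Acyc.align {A : Finset (ℕ × ℕ)} {m : ℕ} {φ : ℕ → Fin m} (h : Acyc A φ) (v : ℕ)
    (c : Fin m) : ∃ ψ : ℕ → Fin m, Acyc A ψ ∧ c = ψ v :=
  ⟨fun x => Equiv.swap (φ v) c (φ x), h.comp _ (Equiv.injective _), by simp⟩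

end Digr

open Digr in
/-- If `D = (D1, v1, u1) ▽ (D2, v2, u2)` is the directed Hajós join of
the disjoint non-empty digraphs `D1` and `D2`, `k ≥ 3`, and both `D1` and `D2` are
`k`-critical, then `D` is `k`-critical. -/
theorem hajos_join_critical (D D1 D2 : Digr) (u1 v1 v2 u2 : ℕ) (k : ℕ)
    (h1 : D1.verts.Nonempty) (h2 : D2.verts.Nonempty)
    (hD : IsHajosJoin D D1 D2 u1 v1 v2 u2)
    (hk : 3 ≤ k) (hc1 : D1.Critical k) (hc2 : D2.Critical k) :
    D.Critical k := by
  obtain ⟨m, rfl⟩ : ∃ m, k = m + 1 := ⟨k - 1, by omega⟩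
  obtain ⟨hdis, ha1, ha2, hV, hA⟩ := hD
  have hmem : ∀ x y, (x, y) ∈ D.arcs ↔ (x, y) ∈ D1.arcs.erase (u1, v1) ∨
      (∃ x' y', (x', y') ∈ D2.arcs.erase (v2, u2) ∧ (if x' = v2 then v1 else x') = x ∧
        (if y' = v2 then v1 else y') = y) ∨ (x = u1 ∧ y = u2) := by
    intro x y
    rw [hA, Finset.mem_union, Finset.mem_union, Finset.mem_image, Finset.mem_singleton,
      or_assoc]
    simp only [Prod.exists, Prod.map, Prod.mk.injEq]
  clear hA
  have hu1 : u1 ∈ D1.verts := (D1.arcs_sub _ ha1).1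
  have hv1 : v1 ∈ D1.verts := (D1.arcs_sub _ ha1).2
  have hv2 : v2 ∈ D2.verts := (D2.arcs_sub _ ha2).1
  have hu2 : u2 ∈ D2.verts := (D2.arcs_sub _ ha2).2
  have huv1 : u1 ≠ v1 := D1.no_loops _ ha1
  have huv2 : v2 ≠ u2 := D2.no_loops _ ha2
  have hd : ∀ x, x ∈ D2.verts → x ∉ D1.verts := fun x h2 h1 =>
    Finset.disjoint_left.mp hdis h1 h2
  have hn1 := hc1.not_colorable
  have hn2 := hc2.not_colorable
  have hsub1 : ∀ b, ∀ a ∈ D1.arcs.erase b, a.1 ∈ D1.verts ∧ a.2 ∈ D1.verts :=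
    fun b a ha => D1.arcs_sub a (Finset.mem_of_mem_erase ha)
  have hsub2 : ∀ b, ∀ a ∈ D2.arcs.erase b, a.1 ∈ D2.verts ∧ a.2 ∈ D2.verts :=
    fun b a ha => D2.arcs_sub a (Finset.mem_of_mem_erase ha)
  have hnot : ¬ D.Colorable m := by
    rintro ⟨φ, hφ⟩
    have p1 : Relation.ReflTransGen (Mono (D1.arcs.erase (u1, v1)) φ) v1 u1 := by
      refine path_of_not_colorable hn1 (Acyc.mono (A := D.arcs) hφ ?_)
      rintro ⟨x, y⟩ hxy
      exact (hmem x y).mpr (Or.inl hxy)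
    have hstep : ∀ x y, Mono (D2.arcs.erase (v2, u2)) (fun x => φ (if x = v2 then v1 else x)) x y →
        Mono D.arcs φ (if x = v2 then v1 else x) (if y = v2 then v1 else y) :=
      fun x y hxy => ⟨(hmem _ _).mpr (Or.inr (Or.inl ⟨x, y, hxy.1, rfl, rfl⟩)), hxy.2⟩
    have p2 : Relation.ReflTransGen (Mono (D2.arcs.erase (v2, u2))
        (fun x => φ (if x = v2 then v1 else x))) u2 v2 := by
      refine path_of_not_colorable hn2 ?_
      intro v hv
      exact hφ _ (tlift (fun x => if x = v2 then v1 else x) hstep hv)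
    have q1 : Relation.ReflTransGen (Mono D.arcs φ) v1 u1 :=
      rmono (fun x y hxy => ⟨(hmem x y).mpr (Or.inl hxy.1), hxy.2⟩) p1
    have q2 := rlift (fun x => if x = v2 then v1 else x) hstep p2
    simp only [if_neg huv2.symm, if_true] at q2
    have e1 := color_eq_of_path q1
    have e2 := color_eq_of_path q2
    have : Mono D.arcs φ u1 u2 := ⟨(hmem _ _).mpr (Or.inr (Or.inr ⟨rfl, rfl⟩)), by rw [e2, e1]⟩
    exact hφ u1 (Relation.TransGen.head' this (q2.trans q1))
  have hcol : ∀ B : Finset (ℕ × ℕ), B ⊆ D.arcs → B ≠ D.arcs →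
      ∃ φ : ℕ → Fin m, Acyc B φ := by
    intro B hB hne
    obtain ⟨⟨a, b⟩, hab, habB⟩ : ∃ e ∈ D.arcs, e ∉ B := by
      by_contra hcon
      push Not at hcon
      exact hne (Finset.Subset.antisymm hB hcon)
    have hneB : ∀ x y, (x, y) ∈ B → ¬ (x = a ∧ y = b) := by
      rintro x y hxy ⟨rfl, rfl⟩
      exact habB hxy
    obtain ⟨φ1, hφ1⟩ := hc1.acyc_erase ha1
    obtain ⟨φ2, hφ2⟩ := hc2.acyc_erase ha2
    rcases (hmem a b).mp hab with h | ⟨a', b', h, rfl, rfl⟩ | ⟨rfl, rfl⟩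
    · obtain ⟨ψ1, hψ1⟩ := hc1.acyc_erase (Finset.mem_of_mem_erase h)
      obtain ⟨ψ2, hψ2, hal⟩ := hφ2.align v2 (ψ1 v1)
      refine ⟨_, glue1 hdis hu1 hv1 hu2 (hsub1 _) (hsub2 _) hψ1 hψ2 hal (u1 := u1) ?_⟩
      intro x y hxy
      rcases (hmem x y).mp (hB hxy) with h' | h' | h'
      · left
        refine Finset.mem_erase.mpr ⟨?_, Finset.mem_of_mem_erase h'⟩
        intro he
        exact habB (he ▸ hxy)
      · exact Or.inr (Or.inl h')
      · refine Or.inr (Or.inr ⟨h'.1, h'.2, ?_, ?_⟩)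
        · exact Finset.mem_erase.mpr ⟨(Finset.ne_of_mem_erase h).symm, ha1⟩
        · exact color_eq_of_path (path_of_not_colorable hn2 hψ2)
    · obtain ⟨ψ0, hψ0⟩ := hc2.acyc_erase (Finset.mem_of_mem_erase h)
      obtain ⟨ψ2, hψ2, hal⟩ := hψ0.align v2 (φ1 v1)
      refine ⟨_, glue2 hdis hu1 hv1 hu2 (hsub1 _) (hsub2 _) hφ1 hψ2 hal (u1 := u1) ?_⟩
      intro x y hxy
      rcases (hmem x y).mp (hB hxy) with h' | ⟨x', y', h', rfl, rfl⟩ | h'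
      · exact Or.inl h'
      · refine Or.inr (Or.inl ⟨x', y', ?_, rfl, rfl⟩)
        refine Finset.mem_erase.mpr ⟨?_, Finset.mem_of_mem_erase h'⟩
        intro he
        obtain ⟨rfl, rfl⟩ := Prod.mk.inj he
        exact habB hxy
      · refine Or.inr (Or.inr ⟨h'.1, h'.2, ?_, ?_⟩)
        · exact Finset.mem_erase.mpr ⟨(Finset.ne_of_mem_erase h).symm, ha2⟩
        · exact (color_eq_of_path (path_of_not_colorable hn1 hφ1)).symm
    · obtain ⟨ψ2, hψ2, hal⟩ := hφ2.align v2 (φ1 v1)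
      refine ⟨_, glue1 hdis hu1 hv1 hu2 (hsub1 _) (hsub2 _) hφ1 hψ2 hal (u1 := a) ?_⟩
      intro x y hxy
      rcases (hmem x y).mp (hB hxy) with h' | h' | h'
      · exact Or.inl h'
      · exact Or.inr (Or.inl h')
      · exact absurd h' (hneB x y hxy)
  have hinc : ∀ w ∈ D.verts, ∃ x y, (x, y) ∈ D.arcs ∧ (x = w ∨ y = w) := by
    intro w hw
    have hlast : (u1, u2) ∈ D.arcs := (hmem _ _).mpr (Or.inr (Or.inr ⟨rfl, rfl⟩))
    rw [hV, Finset.mem_union] at hw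
    rcases hw with hw | hw
    · by_cases hwv : w = v1
      · subst hwv
        obtain ⟨φ1, hφ1⟩ := hc1.acyc_erase ha1
        rcases Relation.ReflTransGen.cases_head (path_of_not_colorable hn1 hφ1) with h | ⟨c, h, -⟩
        · exact absurd h.symm huv1
        · exact ⟨w, c, (hmem _ _).mpr (Or.inl h.1), Or.inl rfl⟩
      · by_cases hwu : w = u1
        · exact ⟨u1, u2, hlast, Or.inl hwu.symm⟩
        · obtain ⟨⟨x, y⟩, hxy, hor⟩ := hc1.exists_arc hw
          refine ⟨x, y, (hmem _ _).mpr (Or.inl (Finset.mem_erase.mpr ⟨?_, hxy⟩)), hor⟩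
          intro he
          obtain ⟨rfl, rfl⟩ := Prod.mk.inj he
          rcases hor with h | h
          · exact hwu h.symm
          · exact hwv h.symm
    · obtain ⟨hwv, hw⟩ := Finset.mem_erase.mp hw
      by_cases hwu : w = u2
      · exact ⟨u1, u2, hlast, Or.inr hwu.symm⟩
      · obtain ⟨⟨x, y⟩, hxy, hor⟩ := hc2.exists_arc hw
        refine ⟨_, _, (hmem _ _).mpr (Or.inr (Or.inl ⟨x, y, Finset.mem_erase.mpr ⟨?_, hxy⟩,
          rfl, rfl⟩)), ?_⟩
        · intro he
          obtain ⟨rfl, rfl⟩ := Prod.mk.inj he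
          rcases hor with h | h
          · exact hwv h.symm
          · exact hwu h.symm
        · rcases hor with h | h
          · left
            simp only at h
            rw [h, if_neg hwv]
          · right
            simp only at h
            rw [h, if_neg hwv]
  refine ⟨le_antisymm ?_ ?_, ?_⟩
  · rw [dichrom_le_iff]
    refine colorable_succ D (u1, u2) m (hcol _ (Finset.erase_subset _ _) ?_)
    intro he
    have hlast : (u1, u2) ∈ D.arcs := (hmem _ _).mpr (Or.inr (Or.inr ⟨rfl, rfl⟩))
    rw [← he] at hlast
    exact Finset.notMem_erase _ _ hlast
  · by_contra hcon
    exact hnot ((dichrom_le_iff _ _).mp (by omega))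
  · rintro D' ⟨hs1, hs2⟩ hne
    have hne' : D'.arcs ≠ D.arcs := by
      intro he
      have hverts : D'.verts = D.verts := by
        refine Finset.Subset.antisymm hs1 ?_
        intro w hw
        obtain ⟨x, y, hxy, hor⟩ := hinc w hw
        rw [← he] at hxy
        have := D'.arcs_sub _ hxy
        rcases hor with rfl | rfl
        · exact this.1
        · exact this.2
      apply hne
      cases D'
      cases D
      simp only at he hverts
      subst he hverts
      rfl
    have := (dichrom_le_iff D' m).mpr (hcol _ hs2 hne')
    omega
end

section
/- Let D = (D₁, v₁, u₁) ▽ (D₂, v₂, u₂) be the directed Hajós join of two disjoint non-empty digraphs D₁ and D₂, and let k ≥ 3. If D is k-critical, then both D₁ and D₂ are k-critical. -/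
namespace HJ

open Relation

/-- Monochromatic arc relation. -/
def M {n : ℕ} (A : Finset (ℕ × ℕ)) (φ : ℕ → Fin n) (x y : ℕ) : Prop := (x, y) ∈ A ∧ φ x = φ y

/-- No monochromatic closed walk. -/
def Good {n : ℕ} (A : Finset (ℕ × ℕ)) (φ : ℕ → Fin n) : Prop := ∀ v, ¬ TransGen (M A φ) v v

/-- Colorability of an arc set. -/
def Col (A : Finset (ℕ × ℕ)) (n : ℕ) : Prop := ∃ φ : ℕ → Fin n, Good A φ

lemma tmono {R S : ℕ → ℕ → Prop} {x y : ℕ} (h : TransGen R x y) (hRS : ∀ a b, R a b → S a b) :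
    TransGen S x y := h.lift id hRS

lemma rmono {R S : ℕ → ℕ → Prop} {x y : ℕ} (h : ReflTransGen R x y)
    (hRS : ∀ a b, R a b → S a b) : ReflTransGen S x y := h.lift id hRS

lemma add_arc {R S : ℕ → ℕ → Prop} {a b : ℕ} (hS : ∀ x y, S x y → R x y ∨ (x = a ∧ y = b))
    {x y : ℕ} (h : TransGen S x y) :
    TransGen R x y ∨ (ReflTransGen R x a ∧ ReflTransGen R b y) := by
  induction h with
  | single h =>
    rcases hS _ _ h with h | ⟨rfl, rfl⟩
    · exact Or.inl (.single h)
    · exact Or.inr ⟨.refl, .refl⟩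
  | tail _ h ih =>
    rcases hS _ _ h with h | ⟨rfl, rfl⟩
    · rcases ih with ih | ⟨i1, i2⟩
      · exact Or.inl (ih.tail h)
      · exact Or.inr ⟨i1, i2.tail h⟩
    · rcases ih with ih | ⟨i1, i2⟩
      · exact Or.inr ⟨ih.to_reflTransGen, .refl⟩
      · exact Or.inr ⟨i1, .refl⟩

lemma add_arc_cycle {R S : ℕ → ℕ → Prop} {a b : ℕ}
    (hS : ∀ x y, S x y → R x y ∨ (x = a ∧ y = b)) (hR : ∀ v, ¬ TransGen R v v)
    {x : ℕ} (h : TransGen S x x) : ReflTransGen R b a := by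
  rcases add_arc hS h with h | ⟨h1, h2⟩
  · exact (hR _ h).elim
  · exact h2.trans h1

lemma glue_path {P Q S : ℕ → ℕ → Prop} {X Y : Set ℕ} {v : ℕ}
    (hS : ∀ x y, S x y → P x y ∨ Q x y)
    (hP : ∀ x y, P x y → x ∈ X ∧ y ∈ X) (hQ : ∀ x y, Q x y → x ∈ Y ∧ y ∈ Y)
    (hv : ∀ x, x ∈ X → x ∈ Y → x = v) {x y : ℕ} (hx : x ∈ Y) (h : ReflTransGen S x y) :
    (y ∈ Y ∧ ReflTransGen Q x y) ∨ (y ∈ X ∧ ReflTransGen Q x v ∧ ReflTransGen P v y) := by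
  induction h with
  | refl => exact Or.inl ⟨hx, .refl⟩
  | tail _ h ih =>
    rcases ih with ⟨hy, i⟩ | ⟨hy, i1, i2⟩
    · rcases hS _ _ h with h | h
      · obtain rfl := hv _ (hP _ _ h).1 hy
        exact Or.inr ⟨(hP _ _ h).2, i, .single h⟩
      · exact Or.inl ⟨(hQ _ _ h).2, i.tail h⟩
    · rcases hS _ _ h with h | h
      · exact Or.inr ⟨(hP _ _ h).2, i1, i2.tail h⟩
      · obtain rfl := hv _ hy (hQ _ _ h).1
        exact Or.inl ⟨(hQ _ _ h).2, i1.tail h⟩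

lemma glue_cycle_aux {P Q S : ℕ → ℕ → Prop} {X Y : Set ℕ} {v : ℕ}
    (hS : ∀ x y, S x y → P x y ∨ Q x y)
    (hP : ∀ x y, P x y → x ∈ X ∧ y ∈ X) (hQ : ∀ x y, Q x y → x ∈ Y ∧ y ∈ Y)
    (hv : ∀ x, x ∈ X → x ∈ Y → x = v) (cP : ∀ v, ¬ TransGen P v v)
    {x y : ℕ} (hx : x ∈ Y) (h : TransGen S x y) :
    (y ∈ Y ∧ TransGen Q x y) ∨ (y ∈ X ∧ ReflTransGen Q x v ∧ TransGen P v y) := by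
  induction h with
  | single h =>
    rcases hS _ _ h with h | h
    · obtain rfl := hv _ (hP _ _ h).1 hx
      exact Or.inr ⟨(hP _ _ h).2, .refl, .single h⟩
    · exact Or.inl ⟨(hQ _ _ h).2, .single h⟩
  | tail _ h ih =>
    rcases ih with ⟨hy, i⟩ | ⟨hy, i1, i2⟩
    · rcases hS _ _ h with h | h
      · obtain rfl := hv _ (hP _ _ h).1 hy
        exact Or.inr ⟨(hP _ _ h).2, i.to_reflTransGen, .single h⟩
      · exact Or.inl ⟨(hQ _ _ h).2, i.tail h⟩
    · rcases hS _ _ h with h | h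
      · exact Or.inr ⟨(hP _ _ h).2, i1, i2.tail h⟩
      · obtain rfl := hv _ hy (hQ _ _ h).1
        exact (cP _ i2).elim

lemma glue_cycle {P Q S : ℕ → ℕ → Prop} {X Y : Set ℕ} {v : ℕ}
    (hS : ∀ x y, S x y → P x y ∨ Q x y)
    (hP : ∀ x y, P x y → x ∈ X ∧ y ∈ X) (hQ : ∀ x y, Q x y → x ∈ Y ∧ y ∈ Y)
    (hv : ∀ x, x ∈ X → x ∈ Y → x = v) (cP : ∀ v, ¬ TransGen P v v) (cQ : ∀ v, ¬ TransGen Q v v)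
    (x : ℕ) : ¬ TransGen S x x := by
  intro h
  have hx : x ∈ X ∨ x ∈ Y := by
    obtain ⟨y, h, _⟩ := TransGen.head'_iff.1 h
    rcases hS _ _ h with h | h
    · exact Or.inl (hP _ _ h).1
    · exact Or.inr (hQ _ _ h).1
  rcases hx with hx | hx
  · rcases glue_cycle_aux (fun x y h => (hS x y h).symm) hQ hP (fun x a b => hv x b a) cQ hx h with
      ⟨_, h⟩ | ⟨hy, _, h⟩
    · exact cP _ h
    · obtain rfl := hv _ hx hy
      exact cQ _ h
  · rcases glue_cycle_aux hS hP hQ hv cP hx h with ⟨_, h⟩ | ⟨hy, _, h⟩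
    · exact cQ _ h
    · obtain rfl := hv _ hy hx
      exact cP _ h

lemma path_color {n : ℕ} {A : Finset (ℕ × ℕ)} {φ : ℕ → Fin n} {x y : ℕ}
    (h : ReflTransGen (M A φ) x y) : φ x = φ y := by
  induction h with
  | refl => rfl
  | tail _ h ih => exact ih.trans h.2

lemma M.mono {n : ℕ} {A B : Finset (ℕ × ℕ)} (h : A ⊆ B) {φ : ℕ → Fin n} (x y : ℕ)
    (hm : M A φ x y) : M B φ x y := ⟨h hm.1, hm.2⟩

lemma Good.mono {n : ℕ} {A B : Finset (ℕ × ℕ)} (h : A ⊆ B) {φ : ℕ → Fin n} (hB : Good B φ) :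
    Good A φ := fun v hv => hB v (tmono hv (M.mono h))

lemma Col.mono {n : ℕ} {A B : Finset (ℕ × ℕ)} (h : A ⊆ B) (hB : Col B n) : Col A n :=
  ⟨hB.choose, hB.choose_spec.mono h⟩

lemma Col.mono_n {m n : ℕ} {A : Finset (ℕ × ℕ)} (h : m ≤ n) (hB : Col A m) : Col A n := by
  obtain ⟨φ, hφ⟩ := hB
  refine ⟨fun x => Fin.castLE h (φ x), fun v hv => hφ v (tmono hv ?_)⟩
  intro x y hm
  exact ⟨hm.1, Fin.castLE_injective h hm.2⟩

lemma Col.succ {n : ℕ} {A : Finset (ℕ × ℕ)} (hl : ∀ a ∈ A, a.1 ≠ a.2) (e : ℕ × ℕ)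
    (h : Col (A.erase e) n) : Col A (n + 1) := by
  obtain ⟨φ, hφ⟩ := h
  refine ⟨fun x => if x = e.1 then Fin.last n else (φ x).castSucc, fun v hv => hφ v (tmono hv ?_)⟩
  rintro x y ⟨hm, hc⟩
  have hne : x ≠ y := hl _ hm
  have h1 : x ≠ e.1 := by
    intro h
    have h' : y ≠ e.1 := by rw [← h]; exact hne.symm
    simp only [h, h', if_true, if_false] at hc
    exact (Fin.castSucc_lt_last _).ne hc.symm
  have h2 : y ≠ e.1 := by
    intro h
    simp only [h, h1, if_true, if_false] at hc
    exact (Fin.castSucc_lt_last _).ne hc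
  simp only [h1, h2, if_false] at hc
  refine ⟨Finset.mem_erase.2 ⟨?_, hm⟩, Fin.castSucc_injective _ hc⟩
  rintro rfl
  exact h1 rfl

lemma exists_col (A : Finset (ℕ × ℕ)) (hl : ∀ a ∈ A, a.1 ≠ a.2) : ∃ n, Col A n := by
  induction A using Finset.induction_on with
  | empty =>
    refine ⟨1, fun _ => 0, fun v hv => ?_⟩
    obtain ⟨y, h, _⟩ := TransGen.head'_iff.1 hv
    simp [M] at h
  | insert a s ha ih =>
    obtain ⟨n, hn⟩ := ih (fun b hb => hl b (Finset.mem_insert_of_mem hb))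
    refine ⟨n + 1, Col.succ hl a ?_⟩
    rwa [Finset.erase_insert ha]

lemma dichrom_le_iff (D : Digr) (n : ℕ) : D.dichrom ≤ n ↔ Col D.arcs n := by
  constructor
  · intro h
    have : Col D.arcs D.dichrom :=
      Nat.sInf_mem (s := {n | D.Colorable n}) (exists_col D.arcs D.no_loops)
    exact this.mono_n h
  · intro h
    exact Nat.sInf_le h

/-- Subdigraph obtained by deleting an arc. -/
def delArc (D : Digr) (e : ℕ × ℕ) : Digr where
  verts := D.verts
  arcs := D.arcs.erase e
  arcs_sub a ha := D.arcs_sub a (Finset.mem_of_mem_erase ha)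
  no_loops a ha := D.no_loops a (Finset.mem_of_mem_erase ha)

lemma critical_iff (D : Digr) (m : ℕ) (hm : 1 ≤ m) : D.Critical (m + 1) ↔
    ¬ Col D.arcs m ∧ (∀ e ∈ D.arcs, Col (D.arcs.erase e) m) ∧
      ∀ x ∈ D.verts, ∃ e ∈ D.arcs, e.1 = x ∨ e.2 = x := by
  constructor
  · rintro ⟨h, hs⟩
    refine ⟨fun hc => ?_, fun e he => ?_, fun x hx => ?_⟩
    · have := (dichrom_le_iff D m).2 hc
      omega
    · have := hs (delArc D e) ⟨subset_rfl, Finset.erase_subset _ _⟩ (fun h => by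
        have h2 := congrArg Digr.arcs h
        have h3 : e ∈ (delArc D e).arcs := by rw [h2]; exact he
        exact Finset.notMem_erase _ _ h3)
      exact (dichrom_le_iff (delArc D e) m).1 (by omega)
    · by_contra! hcon
      have := hs (D.delete x) ⟨Finset.erase_subset _ _, Finset.filter_subset _ _⟩ (fun h => by
        have h3 : x ∈ (D.delete x).verts := by rw [h]; exact hx
        exact Finset.notMem_erase _ _ h3)
      have h2 := (dichrom_le_iff (D.delete x) m).1 (by omega)
      have h3 : (D.delete x).arcs = D.arcs := Finset.filter_true_of_mem hcon
      rw [h3, ← dichrom_le_iff] at h2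
      omega
  · rintro ⟨h, hs, hx⟩
    have hne : D.arcs.Nonempty := by
      by_contra hcon
      rw [Finset.not_nonempty_iff_eq_empty] at hcon
      apply h
      rw [hcon]
      refine ⟨fun _ => ⟨0, hm⟩, fun v hv => ?_⟩
      obtain ⟨y, h, _⟩ := TransGen.head'_iff.1 hv
      simp [M] at h
    refine ⟨?_, fun D' hsub hD => ?_⟩
    · obtain ⟨e, he⟩ := hne
      have h1 := (dichrom_le_iff D (m + 1)).2 (Col.succ D.no_loops e (hs e he))
      rw [← dichrom_le_iff] at h
      omega
    · rw [Nat.lt_succ_iff, dichrom_le_iff]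
      by_cases ha : D'.arcs = D.arcs
      · exfalso
        apply hD
        have hvv : D'.verts = D.verts := by
          refine Finset.Subset.antisymm hsub.1 fun x hxx => ?_
          obtain ⟨e, he, rfl | rfl⟩ := hx x hxx
          · exact (D'.arcs_sub e (ha ▸ he)).1
          · exact (D'.arcs_sub e (ha ▸ he)).2
        cases D'; cases D; simp_all
      · obtain ⟨e, he, he'⟩ := Finset.exists_of_ssubset (lt_of_le_of_ne hsub.2 ha)
        exact (hs e he).mono (fun a h => Finset.mem_erase.2 ⟨fun h' => he' (by rw [← h']; exact h), hsub.2 h⟩)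

section core

variable {m u1 u2 v : ℕ} {X Y : Set ℕ} {B1 B2 A : Finset (ℕ × ℕ)}

lemma glue_good {φ : ℕ → Fin m}
    (hX : ∀ a ∈ B1, a.1 ∈ X ∧ a.2 ∈ X) (hY : ∀ a ∈ B2, a.1 ∈ Y ∧ a.2 ∈ Y)
    (hv : ∀ x, x ∈ X → x ∈ Y → x = v)
    (e1 : (u1, v) ∈ B1) (e2 : (v, u2) ∈ B2) (n1 : u1 ≠ v)
    (hA : A = B1.erase (u1, v) ∪ B2.erase (v, u2) ∪ {(u1, u2)})
    (gP : Good (B1.erase (u1, v)) φ) (gQ : Good (B2.erase (v, u2)) φ)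
    (hno : ¬ (ReflTransGen (M (B2.erase (v, u2)) φ) u2 v ∧
      ReflTransGen (M (B1.erase (u1, v)) φ) v u1)) : Good A φ := by
  have hP : ∀ x y, M (B1.erase (u1, v)) φ x y → x ∈ X ∧ y ∈ X :=
    fun x y h => hX _ (Finset.mem_of_mem_erase h.1)
  have hQ : ∀ x y, M (B2.erase (v, u2)) φ x y → x ∈ Y ∧ y ∈ Y :=
    fun x y h => hY _ (Finset.mem_of_mem_erase h.1)
  have hU : ∀ x y, M (B1.erase (u1, v) ∪ B2.erase (v, u2)) φ x y →
      M (B1.erase (u1, v)) φ x y ∨ M (B2.erase (v, u2)) φ x y := by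
    rintro x y ⟨h, hc⟩
    rcases Finset.mem_union.1 h with h | h
    · exact Or.inl ⟨h, hc⟩
    · exact Or.inr ⟨h, hc⟩
  intro x hx
  have hp := add_arc_cycle (R := M (B1.erase (u1, v) ∪ B2.erase (v, u2)) φ) (a := u1) (b := u2)
    (by
      rintro x y ⟨h, hc⟩
      rw [hA] at h
      rcases Finset.mem_union.1 h with h | h
      · exact Or.inl ⟨h, hc⟩
      · exact Or.inr (by simpa using h)) (glue_cycle hU hP hQ hv gP gQ) hx
  rcases glue_path hU hP hQ hv (hY _ e2).2 hp with ⟨h, _⟩ | ⟨_, h⟩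
  · exact n1 (hv _ (hX _ e1).1 h)
  · exact hno h

lemma merge
    (hX : ∀ a ∈ B1, a.1 ∈ X ∧ a.2 ∈ X) (hY : ∀ a ∈ B2, a.1 ∈ Y ∧ a.2 ∈ Y)
    (hv : ∀ x, x ∈ X → x ∈ Y → x = v) (hvX : v ∈ X)
    (c1 : Col B1 m) (c2 : Col B2 m) : ∃ φ : ℕ → Fin m, Good B1 φ ∧ Good B2 φ := by
  classical
  obtain ⟨φ1, h1⟩ := c1
  obtain ⟨φ2, h2⟩ := c2
  let π := Equiv.swap (φ2 v) (φ1 v)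
  have hπ : π (φ2 v) = φ1 v := Equiv.swap_apply_left _ _
  let φ : ℕ → Fin m := fun x => if x ∈ X then φ1 x else π (φ2 x)
  have hφX : ∀ x ∈ X, φ x = φ1 x := fun x hx => if_pos hx
  have hφY : ∀ x ∈ Y, φ x = π (φ2 x) := by
    intro x hx
    by_cases h : x ∈ X
    · obtain rfl := hv _ h hx
      rw [hφX _ h, hπ]
    · exact if_neg h
  refine ⟨φ, fun x hx => h1 x (tmono hx ?_), fun x hx => h2 x (tmono hx ?_)⟩
  · rintro x y ⟨h, hc⟩
    rw [hφX _ (hX _ h).1, hφX _ (hX _ h).2] at hc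
    exact ⟨h, hc⟩
  · rintro x y ⟨h, hc⟩
    rw [hφY _ (hY _ h).1, hφY _ (hY _ h).2] at hc
    exact ⟨h, π.injective hc⟩

lemma not_good_path {φ : ℕ → Fin m} {B : Finset (ℕ × ℕ)} {a b : ℕ}
    (g : Good (B.erase (a, b)) φ) (h : ¬ Good B φ) : ReflTransGen (M (B.erase (a, b)) φ) b a := by
  unfold Good at h
  push Not at h
  obtain ⟨x, hx⟩ := h
  refine add_arc_cycle (fun x y h => ?_) g hx
  by_cases he : (x, y) = (a, b)
  · right; simpa using he
  · exact Or.inl ⟨Finset.mem_erase.2 ⟨he, h.1⟩, h.2⟩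

lemma good_no_path {φ : ℕ → Fin m} {B : Finset (ℕ × ℕ)} {a b : ℕ} (he : (a, b) ∈ B)
    (g : Good B φ) : ¬ ReflTransGen (M (B.erase (a, b)) φ) b a := by
  intro h
  exact g a (TransGen.head' ⟨he, (path_color h).symm⟩ (rmono h (M.mono (Finset.erase_subset _ _))))

theorem core
    (hX : ∀ a ∈ B1, a.1 ∈ X ∧ a.2 ∈ X) (hY : ∀ a ∈ B2, a.1 ∈ Y ∧ a.2 ∈ Y)
    (hv : ∀ x, x ∈ X → x ∈ Y → x = v)
    (l1 : ∀ a ∈ B1, a.1 ≠ a.2) (l2 : ∀ a ∈ B2, a.1 ≠ a.2)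
    (e1 : (u1, v) ∈ B1) (e2 : (v, u2) ∈ B2)
    (hA : A = B1.erase (u1, v) ∪ B2.erase (v, u2) ∪ {(u1, u2)})
    (hnc : ¬ Col A m) (hcr : ∀ e ∈ A, Col (A.erase e) m) :
    (¬ Col B1 m ∧ ∀ e ∈ B1, Col (B1.erase e) m) ∧ (¬ Col B2 m ∧ ∀ e ∈ B2, Col (B2.erase e) m) := by
  have n1 : u1 ≠ v := l1 _ e1
  have n2 : v ≠ u2 := l2 _ e2
  have hu1 : u1 ∉ Y := fun h => n1 (hv _ (hX _ e1).1 h)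
  have hu2 : u2 ∉ X := fun h => n2 (hv _ h (hY _ e2).2).symm
  have hvX : v ∈ X := (hX _ e1).2
  have m0 : (u1, u2) ∈ A := by rw [hA]; simp
  have sP : B1.erase (u1, v) ⊆ A.erase (u1, u2) := by
    intro a ha
    refine Finset.mem_erase.2 ⟨?_, by rw [hA]; simp only [Finset.mem_union]; tauto⟩
    rintro rfl
    exact hu2 (hX _ (Finset.mem_of_mem_erase ha)).2
  have sQ : B2.erase (v, u2) ⊆ A.erase (u1, u2) := by
    intro a ha
    refine Finset.mem_erase.2 ⟨?_, by rw [hA]; simp only [Finset.mem_union]; tauto⟩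
    rintro rfl
    exact hu1 (hY _ (Finset.mem_of_mem_erase ha)).1
  have cP : Col (B1.erase (u1, v)) m := (hcr _ m0).mono sP
  have cQ : Col (B2.erase (v, u2)) m := (hcr _ m0).mono sQ
  have hX' : ∀ a ∈ B1.erase (u1, v), a.1 ∈ X ∧ a.2 ∈ X :=
    fun a h => hX _ (Finset.mem_of_mem_erase h)
  have hY' : ∀ a ∈ B2.erase (v, u2), a.1 ∈ Y ∧ a.2 ∈ Y :=
    fun a h => hY _ (Finset.mem_of_mem_erase h)
  have disj : ∀ a ∈ B1, a ∉ B2 := by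
    intro a h h'
    apply l1 a h
    rw [hv _ (hX _ h).1 (hY _ h').1, hv _ (hX _ h).2 (hY _ h').2]
  have N1 : ¬ Col B1 m := by
    intro c
    obtain ⟨φ, g1, g2⟩ := merge hX hY' hv hvX c cQ
    exact hnc ⟨φ, glue_good hX hY hv e1 e2 n1 hA (g1.mono (Finset.erase_subset _ _)) g2
      (fun h => good_no_path e1 g1 h.2)⟩
  have N2 : ¬ Col B2 m := by
    intro c
    obtain ⟨φ, g1, g2⟩ := merge hX' hY hv hvX cP c
    exact hnc ⟨φ, glue_good hX hY hv e1 e2 n1 hA g1 (g2.mono (Finset.erase_subset _ _))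
      (fun h => good_no_path e2 g2 h.1)⟩
  -- a monochromatic cycle through the new arc
  have cyc : ∀ (φ : ℕ → Fin m) (C P Q : Finset (ℕ × ℕ)), P ⊆ C → Q ⊆ C → (u1, u2) ∈ C →
      ReflTransGen (M P φ) v u1 → ReflTransGen (M Q φ) u2 v → ¬ Good C φ := by
    intro φ C P Q hP hQ hC p q g
    refine g u1 (TransGen.head' (b := u2) ⟨hC, ?_⟩
      ((rmono q (M.mono hQ)).trans (rmono p (M.mono hP))))
    rw [← path_color p, path_color q]
  refine ⟨⟨N1, fun e he => ?_⟩, ⟨N2, fun e he => ?_⟩⟩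
  · by_cases hee : e = (u1, v)
    · rw [hee]; exact cP
    have heA : e ∈ A := by
      rw [hA]; simp only [Finset.mem_union, Finset.mem_erase]; exact Or.inl (Or.inl ⟨hee, he⟩)
    obtain ⟨φ, g⟩ := hcr e heA
    have sP' : (B1.erase e).erase (u1, v) ⊆ A.erase e := by
      intro a ha
      simp only [Finset.mem_erase] at ha
      exact Finset.mem_erase.2 ⟨ha.2.1,
        Finset.mem_of_mem_erase (sP (Finset.mem_erase.2 ⟨ha.1, ha.2.2⟩))⟩
    have sQ' : B2.erase (v, u2) ⊆ A.erase e := by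
      intro a ha
      refine Finset.mem_erase.2 ⟨?_, Finset.mem_of_mem_erase (sQ ha)⟩
      rintro rfl
      exact disj _ he (Finset.mem_of_mem_erase ha)
    have m0' : (u1, u2) ∈ A.erase e := by
      refine Finset.mem_erase.2 ⟨?_, m0⟩
      rintro rfl
      exact hu2 (hX _ he).2
    refine ⟨φ, ?_⟩
    by_contra hcon
    exact cyc φ _ _ _ sP' sQ' m0' (not_good_path (g.mono sP') hcon)
      (not_good_path (g.mono sQ') (fun h => N2 ⟨φ, h⟩)) g
  · by_cases hee : e = (v, u2)
    · rw [hee]; exact cQ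
    have heA : e ∈ A := by
      rw [hA]; simp only [Finset.mem_union, Finset.mem_erase]; exact Or.inl (Or.inr ⟨hee, he⟩)
    obtain ⟨φ, g⟩ := hcr e heA
    have sQ' : (B2.erase e).erase (v, u2) ⊆ A.erase e := by
      intro a ha
      simp only [Finset.mem_erase] at ha
      exact Finset.mem_erase.2 ⟨ha.2.1,
        Finset.mem_of_mem_erase (sQ (Finset.mem_erase.2 ⟨ha.1, ha.2.2⟩))⟩
    have sP' : B1.erase (u1, v) ⊆ A.erase e := by
      intro a ha
      refine Finset.mem_erase.2 ⟨?_, Finset.mem_of_mem_erase (sP ha)⟩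
      rintro rfl
      exact disj _ (Finset.mem_of_mem_erase ha) he
    have m0' : (u1, u2) ∈ A.erase e := by
      refine Finset.mem_erase.2 ⟨?_, m0⟩
      rintro rfl
      exact hu1 (hY _ he).1
    refine ⟨φ, ?_⟩
    by_contra hcon
    exact cyc φ _ _ _ sP' sQ' m0' (not_good_path (g.mono sP') (fun h => N1 ⟨φ, h⟩))
      (not_good_path (g.mono sQ') hcon) g

end core

lemma col_image {n : ℕ} (s : Equiv.Perm ℕ) (A : Finset (ℕ × ℕ)) :
    Col (A.image (Prod.map s s)) n ↔ Col A n := by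
  constructor
  · rintro ⟨φ, h⟩
    refine ⟨φ ∘ s, fun x hx => h (s x) (hx.lift s ?_)⟩
    rintro x y ⟨h, hc⟩
    exact ⟨Finset.mem_image.2 ⟨(x, y), h, rfl⟩, hc⟩
  · rintro ⟨φ, h⟩
    refine ⟨φ ∘ s.symm, fun x hx => h (s.symm x) (hx.lift s.symm ?_)⟩
    rintro x y ⟨h, hc⟩
    obtain ⟨⟨a, b⟩, hab, he⟩ := Finset.mem_image.1 h
    simp only [Prod.map_apply, Prod.mk.injEq] at he
    obtain ⟨rfl, rfl⟩ := he
    refine ⟨?_, hc⟩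
    simpa using hab

end HJ

open Digr in
/-- If `D = (D1, v1, u1) ▽ (D2, v2, u2)` is the directed Hajós join of
the disjoint non-empty digraphs `D1` and `D2`, `k ≥ 3`, and `D` is `k`-critical,
then both `D1` and `D2` are `k`-critical. -/
theorem hajos_join_critical_converse (D D1 D2 : Digr) (u1 v1 v2 u2 : ℕ) (k : ℕ)
    (h1 : D1.verts.Nonempty) (h2 : D2.verts.Nonempty)
    (hD : IsHajosJoin D D1 D2 u1 v1 v2 u2)
    (hk : 3 ≤ k) (hc : D.Critical k) :
    D1.Critical k ∧ D2.Critical k := by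
  obtain ⟨hdisj, e1, e2, hV, hA⟩ := hD
  obtain ⟨m, rfl⟩ : ∃ m, k = m + 1 := ⟨k - 1, by omega⟩
  have hm : 1 ≤ m := by omega
  rw [HJ.critical_iff _ _ hm] at hc
  obtain ⟨hnc, hcr, hinc⟩ := hc
  have hv1 : v1 ∈ D1.verts := (D1.arcs_sub _ e1).2
  have hv2 : v2 ∈ D2.verts := (D2.arcs_sub _ e2).1
  have hu2 : u2 ∈ D2.verts := (D2.arcs_sub _ e2).2
  have hnot : ∀ x, x ∈ D1.verts → x ∈ D2.verts → False := fun x a b =>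
    Finset.disjoint_left.1 hdisj a b
  have hv1' : v1 ∉ D2.verts := fun h => hnot _ hv1 h
  have hu2v2 : u2 ≠ v2 := fun h => D2.no_loops _ e2 h.symm
  let s : Equiv.Perm ℕ := Equiv.swap v2 v1
  have hs : ∀ x ∈ D2.verts, s x = if x = v2 then v1 else x := by
    intro x hx
    have hx1 : x ≠ v1 := by rintro rfl; exact hv1' hx
    by_cases h : x = v2
    · simp [s, h]
    · simp [s, h, Equiv.swap_apply_of_ne_of_ne h hx1]
  have hsi : Function.Injective (Prod.map s s) := Function.Injective.prodMap s.injective s.injective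
  have hse : Prod.map s s (v2, u2) = (v1, u2) := by
    simp [hs _ hv2, hs _ hu2, hu2v2]
  have hA' : D.arcs = D1.arcs.erase (u1, v1) ∪
      (D2.arcs.image (Prod.map s s)).erase (v1, u2) ∪ {(u1, u2)} := by
    rw [hA, ← hse, ← Finset.image_erase hsi]
    congr 2
    refine Finset.image_congr fun a ha => ?_
    have := D2.arcs_sub a (Finset.mem_of_mem_erase ha)
    simp only [Prod.map, hs _ this.1, hs _ this.2]
  have hY : ∀ a ∈ D2.arcs.image (Prod.map s s), a.1 ∈ s '' (D2.verts : Set ℕ) ∧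
      a.2 ∈ s '' (D2.verts : Set ℕ) := by
    intro a ha
    obtain ⟨b, hb, rfl⟩ := Finset.mem_image.1 ha
    exact ⟨⟨b.1, (D2.arcs_sub b hb).1, rfl⟩, ⟨b.2, (D2.arcs_sub b hb).2, rfl⟩⟩
  have hXY : ∀ x, x ∈ (D1.verts : Set ℕ) → x ∈ s '' (D2.verts : Set ℕ) → x = v1 := by
    rintro x hx ⟨y, hy, rfl⟩
    by_cases h : y = v2
    · rw [hs y hy, if_pos h]
    · rw [hs y hy, if_neg h] at hx
      exact (hnot _ hx hy).elim
  have hcore := HJ.core (m := m) (u1 := u1) (u2 := u2) (v := v1) (X := (D1.verts : Set ℕ))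
    (Y := s '' (D2.verts : Set ℕ)) (B1 := D1.arcs) (B2 := D2.arcs.image (Prod.map s s))
    (A := D.arcs) D1.arcs_sub hY hXY D1.no_loops (by
      intro a ha
      obtain ⟨b, hb, rfl⟩ := Finset.mem_image.1 ha
      exact fun h => D2.no_loops b hb (s.injective h)) e1
      (Finset.mem_image.2 ⟨_, e2, hse⟩) hA' hnc hcr
  obtain ⟨⟨a1, a2⟩, b1, b2⟩ := hcore
  constructor
  · refine (HJ.critical_iff _ _ hm).2 ⟨a1, a2, fun x hx => ?_⟩
    obtain ⟨e, he, hex⟩ := hinc x (by rw [hV]; exact Finset.mem_union_left _ hx)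
    rw [hA'] at he
    simp only [Finset.mem_union, Finset.mem_singleton] at he
    rcases he with (he | he) | he
    · exact ⟨e, Finset.mem_of_mem_erase he, hex⟩
    · have := hY e (Finset.mem_of_mem_erase he)
      have hxv : x = v1 := hXY x hx (by rcases hex with rfl | rfl <;> tauto)
      exact ⟨_, e1, Or.inr hxv.symm⟩
    · subst he
      rcases hex with rfl | rfl
      · exact ⟨_, e1, Or.inl rfl⟩
      · exact (hnot _ hx hu2).elim
  · refine (HJ.critical_iff _ _ hm).2 ⟨fun h => b1 ((HJ.col_image s _).2 h), fun e he => ?_,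
      fun x hx => ?_⟩
    · have := b2 _ (Finset.mem_image_of_mem _ he)
      rwa [← Finset.image_erase hsi, HJ.col_image] at this
    · by_cases hxv : x = v2
      · exact ⟨_, e2, Or.inl hxv.symm⟩
      obtain ⟨e, he, hex⟩ := hinc x (by
        rw [hV]; exact Finset.mem_union_right _ (Finset.mem_erase.2 ⟨hxv, hx⟩))
      rw [hA'] at he
      simp only [Finset.mem_union, Finset.mem_singleton] at he
      rcases he with (he | he) | he
      · have := D1.arcs_sub _ (Finset.mem_of_mem_erase he)
        exact (hnot x (by rcases hex with rfl | rfl <;> tauto) hx).elim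
      · obtain ⟨b, hb, rfl⟩ := Finset.mem_image.1 (Finset.mem_of_mem_erase he)
        have hsx : s x = x := by rw [hs x hx, if_neg hxv]
        refine ⟨b, hb, ?_⟩
        rcases hex with h | h
        · exact Or.inl (s.injective (h.trans hsx.symm))
        · exact Or.inr (s.injective (h.trans hsx.symm))
      · subst he
        rcases hex with rfl | rfl
        · exact (hnot _ (D1.arcs_sub _ e1).1 hx).elim
        · exact ⟨_, e2, Or.inr rfl⟩
end

section
/- Let k ≥ 3 be an integer and let D be a Hajós-k-constructible digraph. Then D is strongly connected. -/
theorem Digr.rtg_avoid_src {r : ℕ → ℕ → Prop} {a b : ℕ} (h : Relation.ReflTransGen r a b) :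
    Relation.ReflTransGen (fun x y => r x y ∧ x ≠ b) a b := by
  induction h using Relation.ReflTransGen.head_induction_on with
  | refl => exact .refl
  | @head a c hac _ ih =>
    by_cases hab : a = b
    · subst hab; exact .refl
    · exact .head ⟨hac, hab⟩ ih

theorem Digr.rtg_avoid_tgt {r : ℕ → ℕ → Prop} {a b : ℕ} (h : Relation.ReflTransGen r a b) :
    Relation.ReflTransGen (fun x y => r x y ∧ y ≠ a) a b := by
  induction h with
  | refl => exact .refl
  | @tail c d _ hcd ih =>
    by_cases hab : d = a
    · subst hab; exact .refl
    · exact .tail ih ⟨hcd, hab⟩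

/-- Replace every arc by a walk, along a vertex map. -/
theorem Digr.rtg_map {r s : ℕ → ℕ → Prop} (f : ℕ → ℕ)
    (hrs : ∀ x y, r x y → Relation.ReflTransGen s (f x) (f y)) {a b : ℕ}
    (h : Relation.ReflTransGen r a b) : Relation.ReflTransGen s (f a) (f b) := by
  induction h with
  | refl => exact .refl
  | tail _ hcd ih => exact ih.trans (hrs _ _ hcd)

theorem Digr.strong_join {D D1 D2 : Digr} {u1 v1 v2 u2 : ℕ}
    (h1 : D1.StronglyConn) (h2 : D2.StronglyConn)
    (h : IsHajosJoin D D1 D2 u1 v1 v2 u2) : D.StronglyConn := by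
  obtain ⟨_, hu1, hu2, hV, hA⟩ := h
  obtain ⟨hu1V, hv1V⟩ := D1.arcs_sub _ hu1
  obtain ⟨hv2V, hu2V⟩ := D2.arcs_sub _ hu2
  have hne : u2 ≠ v2 := fun e => D2.no_loops _ hu2 e.symm
  let g : ℕ → ℕ := fun x => if x = v2 then v1 else x
  have a1 : ∀ x y, (x, y) ∈ D1.arcs → (x, y) ≠ (u1, v1) → (x, y) ∈ D.arcs := by
    intro x y hxy hn
    rw [hA]
    exact Finset.mem_union_left _ (Finset.mem_union_left _ (Finset.mem_erase.mpr ⟨hn, hxy⟩))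
  have a2 : ∀ x y, (x, y) ∈ D2.arcs → (x, y) ≠ (v2, u2) → (g x, g y) ∈ D.arcs := by
    intro x y hxy hn
    rw [hA]
    refine Finset.mem_union_left _ (Finset.mem_union_right _ ?_)
    exact Finset.mem_image.mpr ⟨(x, y), Finset.mem_erase.mpr ⟨hn, hxy⟩, rfl⟩
  have a3 : (u1, u2) ∈ D.arcs := by rw [hA]; simp
  have gv : g v2 = v1 := if_pos rfl
  have gu : g u2 = u2 := if_neg hne
  have p1 : Relation.ReflTransGen (fun a b => (a, b) ∈ D.arcs) u2 v1 := by
    have := Digr.rtg_map (s := fun a b => (a, b) ∈ D.arcs) g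
      (fun x y hxy => .single (a2 x y hxy.1 (fun e => hxy.2 (Prod.mk.inj e).1)))
      (Digr.rtg_avoid_src (h2 _ hu2V _ hv2V))
    rwa [gv, gu] at this
  have p2 : Relation.ReflTransGen (fun a b => (a, b) ∈ D.arcs) v1 u1 :=
    Digr.rtg_map (s := fun a b => (a, b) ∈ D.arcs) id
      (fun x y hxy => .single (a1 x y hxy.1 (fun e => hxy.2 (Prod.mk.inj e).2)))
      (Digr.rtg_avoid_tgt (h1 _ hv1V _ hu1V))
  have q1 : ∀ x ∈ D1.verts, ∀ y ∈ D1.verts,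
      Relation.ReflTransGen (fun a b => (a, b) ∈ D.arcs) x y := by
    intro x hx y hy
    refine Digr.rtg_map id (fun x y hxy => ?_) (h1 x hx y hy)
    by_cases e : (x, y) = (u1, v1)
    · obtain ⟨rfl, rfl⟩ := Prod.mk.inj e
      exact .head a3 p1
    · exact .single (a1 x y hxy e)
  have q2 : ∀ x ∈ D2.verts, ∀ y ∈ D2.verts,
      Relation.ReflTransGen (fun a b => (a, b) ∈ D.arcs) (g x) (g y) := by
    intro x hx y hy
    refine Digr.rtg_map g (fun x y hxy => ?_) (h2 x hx y hy)
    by_cases e : (x, y) = (v2, u2)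
    · obtain ⟨rfl, rfl⟩ := Prod.mk.inj e
      rw [gv, gu]
      exact p2.tail a3
    · exact .single (a2 x y hxy e)
  have key : ∀ x ∈ D.verts, Relation.ReflTransGen (fun a b => (a, b) ∈ D.arcs) x v1 ∧
      Relation.ReflTransGen (fun a b => (a, b) ∈ D.arcs) v1 x := by
    intro x hx
    rw [hV, Finset.mem_union, Finset.mem_erase] at hx
    rcases hx with hx | ⟨hxn, hx⟩
    · exact ⟨q1 _ hx _ hv1V, q1 _ hv1V _ hx⟩
    · have gx : g x = x := if_neg hxn
      have r1 := q2 _ hx _ hv2V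
      have r2 := q2 _ hv2V _ hx
      rw [gv, gx] at r1 r2
      exact ⟨r1, r2⟩
  intro x hx y hy
  exact (key x hx).1.trans (key y hy).2

theorem Digr.strong_ident {D' D : Digr} {I : Finset ℕ} {v : ℕ}
    (hs : D.StronglyConn) (h : IsIdent D' D I v) : D'.StronglyConn := by
  obtain ⟨⟨i, hi⟩, hI, hind, _, hV, hA⟩ := h
  let f : ℕ → ℕ := fun x => if x ∈ I then v else x
  have hf : ∀ x y, (x, y) ∈ D.arcs → (f x, f y) ∈ D'.arcs := by
    intro x y hxy
    rw [hA]
    simp only [Finset.mem_union, Finset.mem_filter, Finset.mem_image, Prod.exists, f]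
    by_cases hx : x ∈ I <;> by_cases hy : y ∈ I
    · exact absurd hxy (hind x hx y hy)
    · exact .inl (.inr ⟨x, y, ⟨hxy, hx, hy⟩, by simp [hx, hy]⟩)
    · exact .inr ⟨x, y, ⟨hxy, hx, hy⟩, by simp [hx, hy]⟩
    · left; left; simp [hx, hy, hxy]
  have hsurj : ∀ x ∈ D'.verts, ∃ z ∈ D.verts, f z = x := by
    intro x hx
    rw [hV, Finset.mem_union, Finset.mem_sdiff, Finset.mem_singleton] at hx
    rcases hx with ⟨hx, hn⟩ | rfl
    · exact ⟨x, hx, if_neg hn⟩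
    · exact ⟨i, hI hi, if_pos hi⟩
  intro x hx y hy
  obtain ⟨x, hxD, rfl⟩ := hsurj x hx
  obtain ⟨y, hyD, rfl⟩ := hsurj y hy
  exact Digr.rtg_map f (fun a b hab => .single (hf a b hab)) (hs x hxD y hyD)

theorem Digr.strong_iso {D D' : Digr} (hs : D.StronglyConn) (h : Iso D D') :
    D'.StronglyConn := by
  obtain ⟨f, hf, ha⟩ := h
  intro x hx y hy
  obtain ⟨x, hxD, rfl⟩ := hf.surjOn hx
  obtain ⟨y, hyD, rfl⟩ := hf.surjOn hy
  refine Digr.rtg_map f (fun a b hab => .single ?_) (hs x hxD y hyD)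
  have hab' := D.arcs_sub _ hab
  exact (ha a hab'.1 b hab'.2).1 hab

open Digr in
/-- For `k ≥ 3`, every Hajós-`k`-constructible digraph is strongly
connected. -/
theorem hajosConstructible_stronglyConnected (k : ℕ) (hk : 3 ≤ k) (D : Digr)
    (hD : HajosConstr k D) :
    D.StronglyConn := by
  induction hD with
  | base D _ h =>
    intro x hx y hy
    by_cases e : x = y
    · subst e; exact .refl
    · refine .single ?_
      rw [h, Finset.mem_filter, Finset.mem_product]
      exact ⟨⟨hx, hy⟩, e⟩
  | join D D1 D2 u1 v1 v2 u2 _ _ h ih1 ih2 => exact Digr.strong_join ih1 ih2 h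
  | ident D' D I v _ h ih => exact Digr.strong_ident ih h
  | iso D D' _ h ih => exact Digr.strong_iso ih h
end

section
/- Let D = D₁ ▽̄ D₂ be the bidirected Hajós join of two disjoint non-empty digraphs D₁ and D₂. Then χ⃗(D) ≥ min{χ⃗(D₁), χ⃗(D₂)}. -/
open Digr in
/-- If `D = D1 ▽̄ D2` is the bidirected Hajós join of the disjoint
non-empty digraphs `D1` and `D2`, then `χ⃗(D) ≥ min (χ⃗(D1)) (χ⃗(D2))`. -/
theorem bidir_hajos_join_dichromatic_ge (D D1 D2 : Digr) (u1 v1 v2 u2 : ℕ)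
    (h1 : D1.verts.Nonempty) (h2 : D2.verts.Nonempty)
    (hD : IsBidirHajosJoin D D1 D2 u1 v1 v2 u2) :
    min D1.dichrom D2.dichrom ≤ D.dichrom := by
  obtain ⟨-, a1, a2, b1, b2, -, hA⟩ := hD
  have hne : {n | D.Colorable n}.Nonempty := by
    refine ⟨D.verts.sup id + 1, fun x => Fin.ofNat _ x, ?_⟩
    intro v hv
    have key : ∀ x y, ((x, y) ∈ D.arcs ∧
        Fin.ofNat (D.verts.sup id + 1) x = Fin.ofNat (D.verts.sup id + 1) y) → False := by
      rintro x y ⟨hxy, he⟩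
      have hs := D.arcs_sub _ hxy
      have hx : x ≤ D.verts.sup id := Finset.le_sup (f := id) hs.1
      have hy : y ≤ D.verts.sup id := Finset.le_sup (f := id) hs.2
      have he' := congrArg Fin.val he
      simp only [Fin.ofNat] at he'
      rw [Nat.mod_eq_of_lt (by omega), Nat.mod_eq_of_lt (by omega)] at he'
      exact D.no_loops _ hxy he'
    obtain ⟨w, -, hw⟩ := Relation.TransGen.tail'_iff.mp hv
    exact key _ _ hw
  obtain ⟨φ, hφ⟩ : D.Colorable D.dichrom := Nat.sInf_mem hne
  have huu : φ u1 ≠ φ u2 := by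
    intro he
    refine hφ u1 (.tail (.single (b := u2) ⟨?_, he⟩) ⟨?_, he.symm⟩) <;> simp [hA]
  by_cases hv : φ v1 = φ u1
  · have hv2 : φ v1 ≠ φ u2 := fun h => huu (hv.symm.trans h)
    have hu2 : u2 ≠ v2 := D2.no_loops _ b1
    refine (min_le_right _ _).trans (Nat.sInf_le ?_)
    refine ⟨fun x => φ (if x = v2 then v1 else x), fun v hc => ?_⟩
    refine hφ _ (Relation.TransGen.lift (fun x => if x = v2 then v1 else x) ?_ _ _ hc)
    rintro x y ⟨hxy, he⟩
    refine ⟨?_, he⟩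
    rw [hA]
    refine Finset.mem_union_left _ (Finset.mem_union_right _ ?_)
    refine Finset.mem_image.mpr ⟨(x, y), ?_, rfl⟩
    refine Finset.mem_erase.mpr ⟨?_, Finset.mem_erase.mpr ⟨?_, hxy⟩⟩
    · intro h
      obtain ⟨rfl, rfl⟩ := Prod.mk.inj h
      simp only [if_neg hu2, if_true] at he
      exact hv2 he.symm
    · intro h
      obtain ⟨rfl, rfl⟩ := Prod.mk.inj h
      simp only [if_neg hu2, if_true] at he
      exact hv2 he
  · refine (min_le_left _ _).trans (Nat.sInf_le ?_)
    refine ⟨φ, fun v hc => hφ v (Relation.TransGen.mono ?_ _ _ hc)⟩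
    rintro x y ⟨hxy, he⟩
    refine ⟨?_, he⟩
    rw [hA]
    refine Finset.mem_union_left _ (Finset.mem_union_left _ ?_)
    refine Finset.mem_erase.mpr ⟨?_, Finset.mem_erase.mpr ⟨?_, hxy⟩⟩
    · intro h
      obtain ⟨rfl, rfl⟩ := Prod.mk.inj h
      exact hv he
    · intro h
      obtain ⟨rfl, rfl⟩ := Prod.mk.inj h
      exact hv he.symm
end

section
/- Let D = D₁ ▽̄ D₂ be the bidirected Hajós join of two disjoint non-empty digraphs D₁ and D₂. If χ⃗(D₁) = χ⃗(D₂) = k and k ≥ 3, then χ⃗(D) = k. -/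
open Digr in
theorem digr_perm_exists {k : ℕ} (hk : 3 ≤ k) (a b p q : Fin k) (hab : a ≠ b) (hpq : p ≠ q) :
    ∃ σ : Equiv.Perm (Fin k), σ p = a ∧ σ q ≠ b := by
  have hq : Equiv.swap p a q ≠ a := by
    intro h
    apply hpq
    apply (Equiv.swap p a).injective
    rw [h, Equiv.swap_apply_left]
  by_cases h : Equiv.swap p a q = b
  · have : ∃ c : Fin k, c ∉ ({a, b} : Finset (Fin k)) := by
      by_contra hc
      push Not at hc
      have h1 := Finset.card_le_card (fun x _ => hc x : (Finset.univ : Finset (Fin k)) ⊆ {a, b})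
      have h2 := Finset.card_le_two (a := a) (b := b)
      simp only [Finset.card_univ, Fintype.card_fin] at h1
      omega
    obtain ⟨c, hc⟩ := this
    simp only [Finset.mem_insert, Finset.mem_singleton, not_or] at hc
    refine ⟨(Equiv.swap p a).trans (Equiv.swap b c), ?_, ?_⟩
    · rw [Equiv.trans_apply, Equiv.swap_apply_left,
        Equiv.swap_apply_of_ne_of_ne hab (Ne.symm hc.1)]
    · rw [Equiv.trans_apply, h, Equiv.swap_apply_left]
      exact hc.2
  · exact ⟨Equiv.swap p a, Equiv.swap_apply_left _ _, h⟩

open Digr in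
theorem digr_digon_ne {D : Digr} {n : ℕ} {φ : ℕ → Fin n} (h : D.GoodColoring n φ) {u v : ℕ}
    (h1 : (u, v) ∈ D.arcs) (h2 : (v, u) ∈ D.arcs) : φ u ≠ φ v := fun e =>
  h u (Relation.TransGen.tail (Relation.TransGen.single ⟨h1, e⟩) ⟨h2, e.symm⟩)

open Digr in
theorem digr_upper (D D1 D2 : Digr) (u1 v1 v2 u2 : ℕ) (k : ℕ)
    (hD : IsBidirHajosJoin D D1 D2 u1 v1 v2 u2)
    (hk : 3 ≤ k) (hc1 : D1.Colorable k) (hc2 : D2.Colorable k) : D.Colorable k := by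
  obtain ⟨hdis, a1, b1, a2, b2, -, harcs⟩ := hD
  obtain ⟨φ1, g1⟩ := hc1
  obtain ⟨φ2, g2⟩ := hc2
  obtain ⟨σ, hσ1, hσ2⟩ := digr_perm_exists hk (φ1 v1) (φ1 u1) (φ2 v2) (φ2 u2)
    (digr_digon_ne g1 b1 a1) (digr_digon_ne g2 b2 a2)
  have hv1 := (D1.arcs_sub _ a1).2
  have hu1 := (D1.arcs_sub _ a1).1
  have hu2 := (D2.arcs_sub _ a2).1
  have hv2 := (D2.arcs_sub _ a2).2
  have hd : ∀ x, x ∈ D1.verts → x ∉ D2.verts := fun x hx hx' =>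
    Finset.disjoint_left.mp hdis hx hx'
  simp only at hv1 hu1 hu2 hv2
  let φ : ℕ → Fin k := fun x => if x ∈ D2.verts then σ (φ2 x) else φ1 x
  have hφ1 : ∀ x, x ∈ D1.verts → φ x = φ1 x := fun x hx => if_neg (hd x hx)
  have hφ2 : ∀ x, x ∈ D2.verts → φ x = σ (φ2 x) := fun x hx => if_pos hx
  let g : ℕ → ℕ := fun x => if x = v2 then v1 else x
  let r : ℕ → ℕ := fun x => if x ∈ D1.verts then x else v1
  let h : ℕ → ℕ := fun x => if x = v1 then v2 else x
  have hgφ : ∀ x, x ∈ D2.verts → φ (g x) = σ (φ2 x) := by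
    intro x hx
    by_cases e : x = v2
    · simp only [g, e, if_true]
      rw [hφ1 _ hv1, hσ1]
    · simp only [g, e, if_false]
      exact hφ2 x hx
  have hrg : ∀ x, x ∈ D2.verts → r (g x) = v1 := by
    intro x hx
    by_cases e : x = v2
    · simp [g, r, e]
    · have : x ∉ D1.verts := fun h' => hd x h' hx
      simp [g, r, e, this]
  have hhg : ∀ x, x ∈ D2.verts → h (g x) = x := by
    intro x hx
    by_cases e : x = v2
    · simp [g, h, e]
    · have : x ≠ v1 := fun h' => hd v1 hv1 (h' ▸ hx)
      simp [g, h, e, this]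
  refine ⟨φ, ?_⟩
  let R1 : ℕ → ℕ → Prop := fun x y => (x, y) ∈ D1.arcs ∧ φ1 x = φ1 y
  let R2 : ℕ → ℕ → Prop := fun x y => (x, y) ∈ D2.arcs ∧ φ2 x = φ2 y
  have step : ∀ x y, ((x, y) ∈ D.arcs ∧ φ x = φ y) →
      Relation.TransGen R1 (r x) (r y) ∨
        (r x = r y ∧ Relation.TransGen R2 (h x) (h y)) := by
    rintro x y ⟨hxy, e⟩
    rw [harcs] at hxy
    simp only [Finset.mem_union, Finset.mem_insert, Finset.mem_singleton, Finset.mem_image,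
      Finset.mem_erase] at hxy
    rcases hxy with (⟨-, -, hxy⟩ | ⟨⟨x', y'⟩, ⟨-, -, hxy⟩, heq⟩) | hxy | hxy
    · left
      have hx := (D1.arcs_sub _ hxy).1
      have hy := (D1.arcs_sub _ hxy).2
      simp only at hx hy
      rw [hφ1 x hx, hφ1 y hy] at e
      simp only [r, hx, hy, if_true]
      exact Relation.TransGen.single ⟨hxy, e⟩
    · right
      have hx := (D2.arcs_sub _ hxy).1
      have hy := (D2.arcs_sub _ hxy).2
      simp only at hx hy
      have ex : g x' = x := congrArg Prod.fst heq
      have ey : g y' = y := congrArg Prod.snd heq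
      subst ex ey
      rw [hgφ _ hx, hgφ _ hy] at e
      rw [hrg _ hx, hrg _ hy, hhg _ hx, hhg _ hy]
      exact ⟨rfl, Relation.TransGen.single ⟨hxy, σ.injective e⟩⟩
    · obtain ⟨rfl, rfl⟩ := Prod.mk.inj hxy
      rw [hφ1 _ hu1, hφ2 _ hu2] at e
      exact absurd e.symm hσ2
    · obtain ⟨rfl, rfl⟩ := Prod.mk.inj hxy
      rw [hφ1 _ hu1, hφ2 _ hu2] at e
      exact absurd e hσ2
  have key : ∀ x y, Relation.TransGen (fun x y => (x, y) ∈ D.arcs ∧ φ x = φ y) x y →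
      Relation.TransGen R1 (r x) (r y) ∨
        (r x = r y ∧ Relation.TransGen R2 (h x) (h y)) := by
    intro x y hxy
    induction hxy with
    | single hs => exact step _ _ hs
    | tail _ hs ih =>
      rcases ih with ih | ⟨ih1, ih2⟩ <;> rcases step _ _ hs with s | ⟨s1, s2⟩
      · exact Or.inl (ih.trans s)
      · exact Or.inl (s1 ▸ ih)
      · exact Or.inl (ih1 ▸ s)
      · exact Or.inr ⟨ih1.trans s1, ih2.trans s2⟩
  intro x hx
  rcases key x x hx with c | ⟨-, c⟩
  · exact g1 _ c
  · exact g2 _ c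

open Digr in
theorem digr_lower (D D1 D2 : Digr) (u1 v1 v2 u2 : ℕ) (n : ℕ)
    (hD : IsBidirHajosJoin D D1 D2 u1 v1 v2 u2)
    (hc : D.Colorable n) : D1.Colorable n ∨ D2.Colorable n := by
  obtain ⟨hdis, a1, b1, a2, b2, -, harcs⟩ := hD
  obtain ⟨φ, hφ⟩ := hc
  by_contra hcon
  push Not at hcon
  obtain ⟨n1, n2⟩ := hcon
  have e1 : φ u1 = φ v1 := by
    by_contra hne
    refine n1 ⟨φ, fun v hv => hφ v (hv.lift id ?_)⟩
    rintro x y ⟨hxy, e⟩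
    refine ⟨?_, e⟩
    rw [harcs]
    simp only [Finset.mem_union, Finset.mem_erase]
    refine Or.inl (Or.inl ⟨?_, ?_, hxy⟩)
    · intro h
      obtain ⟨rfl, rfl⟩ := Prod.mk.inj h
      exact hne e.symm
    · intro h
      obtain ⟨rfl, rfl⟩ := Prod.mk.inj h
      exact hne e
  have hne2 : u2 ≠ v2 := D2.no_loops _ a2
  have e2 : φ u2 = φ v1 := by
    by_contra hne
    let g : ℕ → ℕ := fun x => if x = v2 then v1 else x
    have gu : g u2 = u2 := if_neg hne2
    have gv : g v2 = v1 := if_pos rfl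
    refine n2 ⟨fun x => φ (g x), fun v hv => hφ (g v) (hv.lift g ?_)⟩
    rintro x y ⟨hxy, e⟩
    refine ⟨?_, e⟩
    rw [harcs]
    simp only [Finset.mem_union, Finset.mem_erase, Finset.mem_image]
    refine Or.inl (Or.inr ⟨(x, y), ⟨?_, ?_, hxy⟩, rfl⟩)
    · intro h
      obtain ⟨rfl, rfl⟩ := Prod.mk.inj h
      simp only [gu, gv] at e
      exact hne e
    · intro h
      obtain ⟨rfl, rfl⟩ := Prod.mk.inj h
      simp only [gu, gv] at e
      exact hne e.symm
  refine digr_digon_ne hφ (u := u1) (v := u2) ?_ ?_ (e1.trans e2.symm) <;> rw [harcs] <;> simp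

open Digr in
/-- If `D = D1 ▽̄ D2` is the bidirected Hajós join of the disjoint
non-empty digraphs `D1` and `D2`, `χ⃗(D1) = χ⃗(D2) = k` and `k ≥ 3`, then
`χ⃗(D) = k`. -/
theorem bidir_hajos_join_dichromatic_eq (D D1 D2 : Digr) (u1 v1 v2 u2 : ℕ) (k : ℕ)
    (h1 : D1.verts.Nonempty) (h2 : D2.verts.Nonempty)
    (hD : IsBidirHajosJoin D D1 D2 u1 v1 v2 u2)
    (hk : 3 ≤ k) (hd1 : D1.dichrom = k) (hd2 : D2.dichrom = k) :
    D.dichrom = k := by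


  have pos1 : 0 < D1.dichrom := by omega
  have pos2 : 0 < D2.dichrom := by omega
  have c1 : D1.Colorable k := by
    have := Nat.sInf_mem (Nat.nonempty_of_pos_sInf pos1)
    rw [← hd1]
    exact this
  have c2 : D2.Colorable k := by
    have := Nat.sInf_mem (Nat.nonempty_of_pos_sInf pos2)
    rw [← hd2]
    exact this
  have c : D.Colorable k := digr_upper D D1 D2 u1 v1 v2 u2 k hD hk c1 c2
  apply le_antisymm
  · exact Nat.sInf_le c
  · have hm : D.Colorable D.dichrom := Nat.sInf_mem (s := {n | D.Colorable n}) ⟨k, c⟩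
    rcases digr_lower D D1 D2 u1 v1 v2 u2 _ hD hm with h | h
    · rw [← hd1]
      exact Nat.sInf_le h
    · rw [← hd2]
      exact Nat.sInf_le h
end
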